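/- If j : M → N is a nontrivial elementary embedding between transitive models of ZFC with the same class of ordinals Ω, then at least one of the following holds: (1) the critical sequence ⟨jⁿ(crit(j)) : n < ω⟩ is cofinal in Ω; (2) for some ordinal α ∈ Ω, j[α] ∉ N; (3) for some α ∈ Ω, α is regular in M and singular in N. -/

import Mathlib

open FirstOrder FirstOrder.Language

/-- The language of set theory: one binary relation symbol. -/
def ZFLang : FirstOrder.Language :=
  ⟨fun _ => Empty, fun n => match n with | 2 => Unit | _ => Empty⟩

def memRel : ZFLang.Relations 2 := ()

/-- The membership structure on a class of ZF-sets. -/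
noncomputable instance zfStr (M : Set ZFSet) : ZFLang.Structure ↥M where
  funMap {n} f _ := f.elim
  RelMap {n} r v :=
    match n, r, v with
    | 2, _, v => ((v 0 : ↥M) : ZFSet) ∈ ((v 1 : ↥M) : ZFSet)
    | 0, r, _ => r.elim
    | 1, r, _ => r.elim
    | (_+3), r, _ => r.elim

/-- The formula `x ∈ y`. -/
def mem' {n : ℕ} (x y : Fin n) : ZFLang.BoundedFormula Empty n :=
  Relations.boundedFormula₂ memRel (Term.var (Sum.inr x)) (Term.var (Sum.inr y))

/-- The formula `x = y`. -/
def eq' {n : ℕ} (x y : Fin n) : ZFLang.BoundedFormula Empty n :=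
  Term.bdEqual (Term.var (Sum.inr x)) (Term.var (Sum.inr y))

def extAx : ZFLang.Sentence :=
  ∀' ∀' ((∀' (mem' 2 0 ⇔ mem' 2 1)) ⟹ eq' 0 1)

def pairAx : ZFLang.Sentence :=
  ∀' ∀' ∃' ∀' (mem' 3 2 ⇔ (eq' 3 0 ⊔ eq' 3 1))

def unionAx : ZFLang.Sentence :=
  ∀' ∃' ∀' (mem' 2 1 ⇔ ∃' (mem' 3 0 ⊓ mem' 2 3))

def powerAx : ZFLang.Sentence :=
  ∀' ∃' ∀' (mem' 2 1 ⇔ ∀' (mem' 3 2 ⟹ mem' 3 0))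

def infAx : ZFLang.Sentence :=
  ∃' ((∃' (mem' 1 0 ⊓ ∀' (∼(mem' 2 1)))) ⊓
    (∀' (mem' 1 0 ⟹ ∃' (mem' 2 0 ⊓ ∀' (mem' 3 2 ⇔ (mem' 3 1 ⊔ eq' 3 1))))))

def foundAx : ZFLang.Sentence :=
  ∀' ((∃' (mem' 1 0)) ⟹ ∃' (mem' 1 0 ⊓ ∀' (mem' 2 1 ⟹ ∼(mem' 2 0))))

/-- The separation axiom for a formula with `k` parameters. -/
def sepAx {k : ℕ} (φ : ZFLang.BoundedFormula Empty (k + 1)) : ZFLang.Sentence :=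
  (mem' ⟨k+2, by omega⟩ ⟨k+1, by omega⟩ ⇔
      (mem' ⟨k+2, by omega⟩ ⟨k, by omega⟩ ⊓ φ.liftAt 2 k)).all.ex.all.alls

/-- The collection axiom for a formula with `k` parameters. -/
def collAx {k : ℕ} (φ : ZFLang.BoundedFormula Empty (k + 2)) : ZFLang.Sentence :=
  (mem' ⟨k+2, by omega⟩ ⟨k, by omega⟩ ⟹
      ((φ.liftAt 2 k).ex ⟹
        ((mem' ⟨k+3, by omega⟩ ⟨k+1, by omega⟩ ⊓ φ.liftAt 2 k).ex))).all.ex.all.alls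

def choiceAx : ZFLang.Sentence :=
  (((∀' ((mem' 1 0) ⟹ (∃' (mem' 2 1)))) ⊓
    (∀' ∀' ((((mem' 1 0) ⊓ (mem' 2 0)) ⊓ (∼(eq' 1 2))) ⟹ (∀' (∼((mem' 3 1) ⊓ (mem' 3 2)))))))
   ⟹
   (∃' ∀' ((mem' 2 0) ⟹
      (∃' (((mem' 3 2) ⊓ (mem' 3 1)) ⊓
        (∀' (((mem' 4 2) ⊓ (mem' 4 1)) ⟹ (eq' 4 3)))))))).all

/-- The ZFC axioms: extensionality, pairing, union, powerset, infinity, foundation, choice,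
separation, and collection. -/
def ZFCTheory : ZFLang.Theory :=
  {extAx, pairAx, unionAx, powerAx, infAx, foundAx, choiceAx} ∪
    (⋃ (k : ℕ), Set.range (@sepAx k)) ∪ (⋃ (k : ℕ), Set.range (@collAx k))

/-- A class of ZF-sets is transitive. -/
def SetTransitive (M : Set ZFSet) : Prop := ∀ x ∈ M, ∀ y : ZFSet, y ∈ x → y ∈ M

/-- A transitive model of ZFC. -/
def IsZFCModel (M : Set ZFSet) : Prop := SetTransitive M ∧ ZFCTheory.Model ↥M

/-- Two classes have the same ordinals. -/
def SameOrdinals (M N : Set ZFSet) : Prop :=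
  ∀ x : ZFSet, x.IsOrdinal → (x ∈ M ↔ x ∈ N)

/-- `z` is the pointwise image `j[x]` of `x` under `j`. -/
def ImageSet (M N : Set ZFSet) (j : ↥M → ↥N) (x z : ZFSet) : Prop :=
  ∀ w : ZFSet, w ∈ z ↔ ∃ y : ↥M, (y : ZFSet) ∈ x ∧ ((j y : ↥N) : ZFSet) = w

/-- `j : M → N` is amenable: every pointwise image `j[x]`, `x ∈ M`, belongs to `N`. -/
def Amenable (M N : Set ZFSet) (j : ↥M → ↥N) : Prop :=
  ∀ x ∈ M, ∃ z ∈ N, ImageSet M N j x z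

/-- `κ` is the critical point of `j`: the least ordinal moved. -/
def IsCrit (M N : Set ZFSet) (j : ↥M → ↥N) (κ : ZFSet) : Prop :=
  κ.IsOrdinal ∧ ∃ h : κ ∈ M, ((j ⟨κ, h⟩ : ↥N) : ZFSet) ≠ κ ∧
    ∀ β : ZFSet, β ∈ κ → ∀ hb : β ∈ M, ((j ⟨β, hb⟩ : ↥N) : ZFSet) = β

/-- `f` is a cofinal map from `β` into the ordinal `α`. -/
def CofinalIn (β α f : ZFSet) : Prop :=
  ∀ γ, γ ∈ α → ∃ ξ, ξ ∈ β ∧ ∃ η, ξ.pair η ∈ f ∧ (γ ∈ η ∨ γ = η)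

/-- `α` is a regular ordinal from the point of view of the class `M`. -/
def RegularIn (M : Set ZFSet) (α : ZFSet) : Prop :=
  ∀ β, β ∈ α → ∀ f, f ∈ M → ZFSet.IsFunc β α f → ¬ CofinalIn β α f

namespace TransModel

universe u

variable {M N : Set ZFSet.{u}} {n : ℕ}

/-- `P` and `Q` are defined over `M` and `N` by one formula, whose parameters in `M` are moved
by `j` for the interpretation in `N`. -/
class Tr (j : M → N) {n : ℕ} (P Q : (Fin n → ZFSet.{u}) → Prop) : Prop where
  out : ∃ φ : ZFLang.BoundedFormula ↥M n,
    (∀ v : Fin n → M, φ.Realize (fun a => a) v ↔ P fun i => (v i : ZFSet)) ∧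
    ∀ v : Fin n → N, φ.Realize j v ↔ Q fun i => (v i : ZFSet)

theorem Tr.congr {j : M → N} {P Q P' Q' : (Fin n → ZFSet.{u}) → Prop} (h : Tr j P Q)
    (hP : ∀ v : Fin n → M, P (fun i => (v i : ZFSet)) ↔ P' fun i => (v i : ZFSet))
    (hQ : ∀ v : Fin n → N, Q (fun i => (v i : ZFSet)) ↔ Q' fun i => (v i : ZFSet)) :
    Tr j P' Q' := by
  obtain ⟨φ, h1, h2⟩ := h
  exact ⟨φ, fun v => (h1 v).trans (hP v), fun v => (h2 v).trans (hQ v)⟩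

theorem realize_memRel {K : Set ZFSet.{u}} {α : Type*} {n : ℕ} {s t : ZFLang.Term (α ⊕ Fin n)}
    {w : α → K} {v : Fin n → K} :
    (Relations.boundedFormula₂ memRel s t).Realize w v ↔
      ((s.realize (Sum.elim w v) : K) : ZFSet) ∈ ((t.realize (Sum.elim w v) : K) : ZFSet) := by
  rw [BoundedFormula.realize_rel₂]
  rfl

variable {j : M → N}

instance Tr.and {P Q P' Q' : (Fin n → ZFSet.{u}) → Prop} [h : Tr j P Q] [h' : Tr j P' Q'] :
    Tr j (fun v => P v ∧ P' v) (fun v => Q v ∧ Q' v) := by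
  obtain ⟨φ, h1, h2⟩ := h
  obtain ⟨ψ, h3, h4⟩ := h'
  exact ⟨φ ⊓ ψ, fun v => by simp [h1, h3], fun v => by simp [h2, h4]⟩

instance Tr.not {P Q : (Fin n → ZFSet.{u}) → Prop} [h : Tr j P Q] :
    Tr j (fun v => ¬ P v) (fun v => ¬ Q v) := by
  obtain ⟨φ, h1, h2⟩ := h
  exact ⟨∼φ, fun v => by simp [h1], fun v => by simp [h2]⟩

instance Tr.or {P Q P' Q' : (Fin n → ZFSet.{u}) → Prop} [h : Tr j P Q] [h' : Tr j P' Q'] :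
    Tr j (fun v => P v ∨ P' v) (fun v => Q v ∨ Q' v) := by
  obtain ⟨φ, h1, h2⟩ := h
  obtain ⟨ψ, h3, h4⟩ := h'
  exact ⟨φ ⊔ ψ, fun v => by simp [h1, h3], fun v => by simp [h2, h4]⟩

instance Tr.imp {P Q P' Q' : (Fin n → ZFSet.{u}) → Prop} [h : Tr j P Q] [h' : Tr j P' Q'] :
    Tr j (fun v => P v → P' v) (fun v => Q v → Q' v) := by
  obtain ⟨φ, h1, h2⟩ := h
  obtain ⟨ψ, h3, h4⟩ := h'
  exact ⟨φ.imp ψ, fun v => by simp [h1, h3], fun v => by simp [h2, h4]⟩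

instance Tr.iff {P Q P' Q' : (Fin n → ZFSet.{u}) → Prop} [h : Tr j P Q] [h' : Tr j P' Q'] :
    Tr j (fun v => P v ↔ P' v) (fun v => Q v ↔ Q' v) := by
  obtain ⟨φ, h1, h2⟩ := h
  obtain ⟨ψ, h3, h4⟩ := h'
  exact ⟨φ.iff ψ, fun v => by simp [h1, h3], fun v => by simp [h2, h4]⟩

instance Tr.all {P Q : (Fin n → ZFSet.{u}) → ZFSet.{u} → Prop}
    [h : Tr j (fun w : Fin (n + 1) → ZFSet.{u} => P (fun i => w i.castSucc) (w (Fin.last n)))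
      (fun w => Q (fun i => w i.castSucc) (w (Fin.last n)))] :
    Tr j (fun v => ∀ x, x ∈ M → P v x) (fun v => ∀ x, x ∈ N → Q v x) := by
  obtain ⟨φ, h1, h2⟩ := h
  refine ⟨φ.all, fun v => ?_, fun v => ?_⟩
  · simp [h1]
  · simp [h2]

instance Tr.ex {P Q : (Fin n → ZFSet.{u}) → ZFSet.{u} → Prop}
    [h : Tr j (fun w : Fin (n + 1) → ZFSet.{u} => P (fun i => w i.castSucc) (w (Fin.last n)))
      (fun w => Q (fun i => w i.castSucc) (w (Fin.last n)))] :
    Tr j (fun v => ∃ x, x ∈ M ∧ P v x) (fun v => ∃ x, x ∈ N ∧ Q v x) := by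
  obtain ⟨φ, h1, h2⟩ := h
  refine ⟨φ.ex, fun v => ?_, fun v => ?_⟩
  · simp [h1]
  · simp [h2]

theorem Tr.mem_var (i k : Fin n) :
    Tr j (fun v : Fin n → ZFSet.{u} => v i ∈ v k) (fun v => v i ∈ v k) :=
  ⟨Relations.boundedFormula₂ memRel (Term.var (Sum.inr i)) (Term.var (Sum.inr k)),
    fun _ => realize_memRel, fun _ => realize_memRel⟩

theorem Tr.eq_var (i k : Fin n) :
    Tr j (fun v : Fin n → ZFSet.{u} => v i = v k) (fun v => v i = v k) :=
  ⟨Term.bdEqual (Term.var (Sum.inr i)) (Term.var (Sum.inr k)),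
    fun v => by simp [Subtype.ext_iff], fun v => by simp [Subtype.ext_iff]⟩

theorem Tr.eq_const (i : Fin n) (a : M) :
    Tr j (fun v : Fin n → ZFSet.{u} => v i = a) (fun v => v i = j a) :=
  ⟨Term.bdEqual (Term.var (Sum.inr i)) (Term.var (Sum.inl a)),
    fun v => by simp [Subtype.ext_iff], fun v => by simp [Subtype.ext_iff]⟩

theorem Tr.rename {m : ℕ} {P Q : (Fin n → ZFSet.{u}) → Prop} (h : Tr j P Q) (σ : Fin n → Fin m) :
    Tr j (fun v : Fin m → ZFSet.{u} => P fun i => v (σ i)) (fun v => Q fun i => v (σ i)) := by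
  obtain ⟨φ, h1, h2⟩ := h
  have key : ∀ (K : Set ZFSet.{u}) (w : M → K) (v : Fin m → K),
      (BoundedFormula.relabel (n := m) (k := 0) (Sum.map id σ) φ.toFormula).Realize w v ↔
        φ.Realize w (fun i => v (σ i)) := by
    intro K w v
    rw [BoundedFormula.realize_relabel]
    have := BoundedFormula.realize_toFormula φ
      (Sum.elim w (v ∘ Fin.castAdd 0) ∘ Sum.map id σ)
    rw [Formula.Realize, Unique.eq_default (default : Fin 0 → K)] at this
    rw [Unique.eq_default (v ∘ Fin.natAdd m : Fin 0 → K)]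
    refine this.trans ?_
    rfl
  exact ⟨BoundedFormula.relabel (n := m) (k := 0) (Sum.map id σ) φ.toFormula,
    fun v => (key M _ v).trans (h1 _), fun v => (key N _ v).trans (h2 _)⟩

/-- `t` and `s` are operations on `M` and `N` whose graphs are defined by one formula. -/
class Tm (j : M → N) {n : ℕ} (t s : (Fin n → ZFSet.{u}) → ZFSet.{u}) : Prop where
  memL : ∀ v : Fin n → M, t (fun i => (v i : ZFSet)) ∈ M
  memR : ∀ v : Fin n → N, s (fun i => (v i : ZFSet)) ∈ N
  graph : Tr j (fun w : Fin (n + 1) → ZFSet.{u} => w (Fin.last n) = t fun i => w i.castSucc)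
    (fun w => w (Fin.last n) = s fun i => w i.castSucc)

instance Tm.var (i : Fin n) : Tm j (fun v : Fin n → ZFSet.{u} => v i) (fun v => v i) :=
  ⟨fun v => (v i).2, fun v => (v i).2, Tr.eq_var _ _⟩

instance Tm.const (a : M) :
    Tm j (fun _ : Fin n → ZFSet.{u} => (a : ZFSet)) (fun _ => (j a : ZFSet)) :=
  ⟨fun _ => a.2, fun _ => (j a).2, Tr.eq_const _ _⟩

theorem Tm.weaken {t s : (Fin n → ZFSet.{u}) → ZFSet.{u}} (h : Tm j t s) :
    Tm j (fun w : Fin (n + 1) → ZFSet.{u} => t fun i => w i.castSucc)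
      (fun w => s fun i => w i.castSucc) := by
  refine ⟨fun v => h.memL fun i => v i.castSucc, fun v => h.memR fun i => v i.castSucc, ?_⟩
  have := h.graph.rename (m := n + 1 + 1) (Fin.lastCases (Fin.last _) fun i => i.castSucc.castSucc)
  simpa using this

theorem Tr.subst {P Q : (Fin n → ZFSet.{u}) → ZFSet.{u} → Prop}
    {t s : (Fin n → ZFSet.{u}) → ZFSet.{u}} (ht : Tm j t s)
    (h : Tr j (fun w : Fin (n + 1) → ZFSet.{u} => P (fun i => w i.castSucc) (w (Fin.last n)))
      (fun w => Q (fun i => w i.castSucc) (w (Fin.last n)))) :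
    Tr j (fun v => P v (t v)) (fun v => Q v (s v)) := by
  have := ht.graph
  refine Tr.congr (P := fun v => ∃ x, x ∈ M ∧ (x = t v ∧ P v x))
    (Q := fun v => ∃ x, x ∈ N ∧ (x = s v ∧ Q v x)) inferInstance ?_ ?_
  · intro v
    simp [ht.memL]
  · intro v
    simp [ht.memR]

theorem Tr.subst1 {P Q : ZFSet.{u} → Prop} {t s : (Fin n → ZFSet.{u}) → ZFSet.{u}}
    (h : Tr j (fun w : Fin 1 → ZFSet.{u} => P (w 0)) (fun w => Q (w 0))) (ht : Tm j t s) :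
    Tr j (fun v => P (t v)) (fun v => Q (s v)) :=
  Tr.subst (P := fun _ => P) (Q := fun _ => Q) ht (h.rename fun _ => Fin.last n)

theorem Tr.subst2 {P Q : ZFSet.{u} → ZFSet.{u} → Prop}
    {t s t' s' : (Fin n → ZFSet.{u}) → ZFSet.{u}}
    (h : Tr j (fun w : Fin 2 → ZFSet.{u} => P (w 0) (w 1)) (fun w => Q (w 0) (w 1)))
    (ht : Tm j t s) (ht' : Tm j t' s') :
    Tr j (fun v => P (t v) (t' v)) (fun v => Q (s v) (s' v)) := by
  refine Tr.subst (P := fun v x => P x (t' v)) (Q := fun v x => Q x (s' v)) ht ?_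
  refine Tr.subst (P := fun w y => P (w (Fin.last n)) y) (Q := fun w y => Q (w (Fin.last n)) y)
    ht'.weaken ?_
  exact h.rename ![(Fin.last n).castSucc, Fin.last (n + 1)]

theorem Tr.subst3 {P Q : ZFSet.{u} → ZFSet.{u} → ZFSet.{u} → Prop}
    {t s t' s' t'' s'' : (Fin n → ZFSet.{u}) → ZFSet.{u}}
    (h : Tr j (fun w : Fin 3 → ZFSet.{u} => P (w 0) (w 1) (w 2)) (fun w => Q (w 0) (w 1) (w 2)))
    (ht : Tm j t s) (ht' : Tm j t' s') (ht'' : Tm j t'' s'') :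
    Tr j (fun v => P (t v) (t' v) (t'' v)) (fun v => Q (s v) (s' v) (s'' v)) := by
  refine Tr.subst (P := fun v x => P x (t' v) (t'' v)) (Q := fun v x => Q x (s' v) (s'' v)) ht ?_
  refine Tr.subst (P := fun w y => P (w (Fin.last n)) y (t'' fun i => w i.castSucc))
    (Q := fun w y => Q (w (Fin.last n)) y (s'' fun i => w i.castSucc)) ht'.weaken ?_
  refine Tr.subst (P := fun w z => P (w (Fin.last n).castSucc) (w (Fin.last (n + 1))) z)
    (Q := fun w z => Q (w (Fin.last n).castSucc) (w (Fin.last (n + 1))) z) ht''.weaken.weaken ?_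
  exact h.rename ![(Fin.last n).castSucc.castSucc, (Fin.last (n + 1)).castSucc, Fin.last (n + 2)]

section

variable {t s t' s' : (Fin n → ZFSet.{u}) → ZFSet.{u}}

instance Tr.mem [ht : Tm j t s] [ht' : Tm j t' s'] :
    Tr j (fun v => t v ∈ t' v) (fun v => s v ∈ s' v) :=
  Tr.subst2 (P := fun x y => x ∈ y) (Q := fun x y => x ∈ y) (Tr.mem_var 0 1) ht ht'

instance Tr.eq [ht : Tm j t s] [ht' : Tm j t' s'] :
    Tr j (fun v => t v = t' v) (fun v => s v = s' v) :=
  Tr.subst2 (P := fun x y => x = y) (Q := fun x y => x = y) (Tr.eq_var 0 1) ht ht'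

end

/-- A transitive model of ZFC, as a class for instance resolution. -/
class Mdl (K : Set ZFSet.{u}) : Prop where
  out : IsZFCModel K

theorem Mdl.trans (K : Set ZFSet.{u}) [hK : Mdl K] {x y : ZFSet.{u}} (hx : x ∈ K) (hy : y ∈ x) :
    y ∈ K :=
  hK.out.1 x hx y hy

section bounded

variable [Mdl M] [Mdl N] {t s : (Fin n → ZFSet.{u}) → ZFSet.{u}}

instance Tr.ball {P Q : (Fin n → ZFSet.{u}) → ZFSet.{u} → Prop} [ht : Tm j t s]
    [h : Tr j (fun w : Fin (n + 1) → ZFSet.{u} => P (fun i => w i.castSucc) (w (Fin.last n)))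
      (fun w => Q (fun i => w i.castSucc) (w (Fin.last n)))] :
    Tr j (fun v => ∀ x, x ∈ t v → P v x) (fun v => ∀ x, x ∈ s v → Q v x) := by
  have := ht.weaken
  refine Tr.congr (P := fun v => ∀ x, x ∈ M → (x ∈ t v → P v x))
    (Q := fun v => ∀ x, x ∈ N → (x ∈ s v → Q v x)) inferInstance ?_ ?_
  · exact fun v => ⟨fun h x hx => h x (Mdl.trans M (ht.memL v) hx) hx, fun h x _ hx => h x hx⟩
  · exact fun v => ⟨fun h x hx => h x (Mdl.trans N (ht.memR v) hx) hx, fun h x _ hx => h x hx⟩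

instance Tr.bex {P Q : (Fin n → ZFSet.{u}) → ZFSet.{u} → Prop} [ht : Tm j t s]
    [h : Tr j (fun w : Fin (n + 1) → ZFSet.{u} => P (fun i => w i.castSucc) (w (Fin.last n)))
      (fun w => Q (fun i => w i.castSucc) (w (Fin.last n)))] :
    Tr j (fun v => ∃ x, x ∈ t v ∧ P v x) (fun v => ∃ x, x ∈ s v ∧ Q v x) := by
  have := ht.weaken
  refine Tr.congr (P := fun v => ∃ x, x ∈ M ∧ (x ∈ t v ∧ P v x))
    (Q := fun v => ∃ x, x ∈ N ∧ (x ∈ s v ∧ Q v x)) inferInstance ?_ ?_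
  · exact fun v => ⟨fun ⟨x, _, h⟩ => ⟨x, h⟩, fun ⟨x, h⟩ => ⟨x, Mdl.trans M (ht.memL v) h.1, h⟩⟩
  · exact fun v => ⟨fun ⟨x, _, h⟩ => ⟨x, h⟩, fun ⟨x, h⟩ => ⟨x, Mdl.trans N (ht.memR v) h.1, h⟩⟩

end bounded

/-- Definability with parameters over one class. -/
abbrev Df (K : Set ZFSet.{u}) {n : ℕ} (P : (Fin n → ZFSet.{u}) → Prop) : Prop :=
  Tr (fun x : K => x) P P

abbrev D1 (K : Set ZFSet.{u}) (P : ZFSet.{u} → Prop) : Prop :=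
  Df K fun v : Fin 1 → ZFSet.{u} => P (v 0)

abbrev D2 (K : Set ZFSet.{u}) (P : ZFSet.{u} → ZFSet.{u} → Prop) : Prop :=
  Df K fun v : Fin 2 → ZFSet.{u} => P (v 0) (v 1)

/-- Definable relations are realised by formulas with finitely many bound parameters. -/
theorem Df.exists_formula {K : Set ZFSet.{u}} {P : (Fin n → ZFSet.{u}) → Prop} (h : Df K P) :
    ∃ (k : ℕ) (p : Fin k → K) (φ : ZFLang.BoundedFormula Empty (k + n)),
      ∀ v : Fin n → K, φ.Realize default (Fin.append p v) ↔ P fun i => (v i : ZFSet) := by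
  classical
  obtain ⟨φ, h1, -⟩ := h
  let e := φ.freeVarFinset.equivFin
  refine ⟨φ.freeVarFinset.card, fun i => (e.symm i : K),
    (φ.restrictFreeVar e).relabel (fun i => Sum.inr i), fun v => ?_⟩
  rw [BoundedFormula.realize_relabel, ← h1]
  have : (Fin.append (fun i => (e.symm i : K)) v) ∘ Fin.natAdd _ = v := by
    funext i; simp
  rw [this]
  apply BoundedFormula.realize_restrictFreeVar
  intro a
  simp

end TransModel

namespace TransModel

universe u

variable {M N K : Set ZFSet.{u}} {n : ℕ}

theorem Tr.transfer {j : M ↪ₑ[ZFLang] N} {P Q : Prop}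
    (h : Tr (n := 0) j (fun _ => P) fun _ => Q) : P ↔ Q := by
  obtain ⟨φ, h1, h2⟩ := h
  rw [← h1 default, ← h2 default, ← j.map_boundedFormula φ (fun a => a) default]
  rw [Unique.eq_default (j ∘ (default : Fin 0 → M))]
  rfl

theorem Tm.map_eq {j : M ↪ₑ[ZFLang] N} {t s : ZFSet.{u}}
    (h : Tm (n := 0) j (fun _ => t) fun _ => s) (ht : t ∈ M) : (j ⟨t, ht⟩ : ZFSet) = s :=
  (Tr.transfer (j := j) (P := ((⟨t, ht⟩ : M) : ZFSet) = t) (Q := (j ⟨t, ht⟩ : ZFSet) = s)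
    inferInstance).1 rfl

theorem realize_mem' {x y : Fin n} {v : Fin n → K} :
    (mem' x y).Realize default v ↔ (v x : ZFSet) ∈ (v y : ZFSet) :=
  realize_memRel

theorem realize_eq' {x y : Fin n} {v : Fin n → K} :
    (eq' x y).Realize default v ↔ (v x : ZFSet) = (v y : ZFSet) := by
  simp [eq', Subtype.ext_iff]

section axioms

theorem Mdl.ext_mem (K : Set ZFSet.{u}) [Mdl K] {x y : ZFSet.{u}} (hx : x ∈ K) (hy : y ∈ K)
    (h : ∀ z, z ∈ K → (z ∈ x ↔ z ∈ y)) : x = y := by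
  ext z
  exact ⟨fun hz => (h z (Mdl.trans K hx hz)).1 hz, fun hz => (h z (Mdl.trans K hy hz)).2 hz⟩

variable [hK : Mdl K]

theorem Mdl.pair_mem {x y : ZFSet.{u}} (hx : x ∈ K) (hy : y ∈ K) : ({x, y} : ZFSet) ∈ K := by
  have h := hK.out.2.realize_of_mem pairAx (by simp [ZFCTheory])
  simp [pairAx, Sentence.Realize, Formula.Realize, realize_mem', realize_eq', Fin.snoc] at h
  obtain ⟨z, hz, h⟩ := h x hx y hy
  convert hz
  ext w
  rw [ZFSet.mem_pair]
  constructor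
  · rintro (rfl | rfl)
    · simp [h _ hx]
    · simp [h _ hy]
  · exact fun hw => (h w (Mdl.trans K hz hw)).1 hw

theorem Mdl.sUnion_mem {x : ZFSet.{u}} (hx : x ∈ K) : ZFSet.sUnion x ∈ K := by
  have h := hK.out.2.realize_of_mem unionAx (by simp [ZFCTheory])
  simp [unionAx, Sentence.Realize, Formula.Realize, realize_mem', Fin.snoc] at h
  obtain ⟨z, hz, h⟩ := h x hx
  convert hz
  ext w
  rw [ZFSet.mem_sUnion]
  constructor
  · rintro ⟨y, hy, hw⟩
    have hyK := Mdl.trans K hx hy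
    exact (h w (Mdl.trans K hyK hw)).2 ⟨y, hy, hyK, hw⟩
  · intro hw
    obtain ⟨y, hy, -, hw⟩ := (h w (Mdl.trans K hz hw)).1 hw
    exact ⟨y, hy, hw⟩

theorem Mdl.exists_powerset {x : ZFSet.{u}} (hx : x ∈ K) :
    ∃ y, y ∈ K ∧ ∀ z, z ∈ K → (z ∈ y ↔ z ⊆ x) := by
  have h := hK.out.2.realize_of_mem powerAx (by simp [ZFCTheory])
  simp [powerAx, Sentence.Realize, Formula.Realize, realize_mem', Fin.snoc] at h
  obtain ⟨y, hy, h⟩ := h x hx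
  refine ⟨y, hy, fun z hz => (h z hz).trans ⟨fun h w hw => h w (Mdl.trans K hz hw) hw,
    fun h w _ hw => h hw⟩⟩

theorem Mdl.exists_inductive (K : Set ZFSet.{u}) [hK : Mdl K] :
    ∃ x, x ∈ K ∧ ∅ ∈ x ∧ ∀ y, y ∈ x → insert y y ∈ x := by
  have h := hK.out.2.realize_of_mem infAx (by simp [ZFCTheory])
  simp [infAx, Sentence.Realize, Formula.Realize, realize_mem', realize_eq', Fin.snoc] at h
  obtain ⟨x, ⟨e, hex, -, he⟩, hx, h⟩ := h
  refine ⟨x, hx, ?_, fun y hy => ?_⟩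
  · convert hex
    symm
    rw [ZFSet.eq_empty]
    exact fun z hz => he z (Mdl.trans K (Mdl.trans K hx hex) hz) hz
  · obtain ⟨z, hz, hzK, h⟩ := h y (Mdl.trans K hx hy) hy
    convert hz
    refine ZFSet.ext fun w => ⟨fun hw => ?_, fun hw => ?_⟩
    · rcases ZFSet.mem_insert_iff.1 hw with rfl | hw
      · exact (h _ (Mdl.trans K hx hy)).2 (Or.inr rfl)
      · exact (h _ (Mdl.trans K (Mdl.trans K hx hy) hw)).2 (Or.inl hw)
    · exact ZFSet.mem_insert_iff.2 ((h _ (Mdl.trans K hzK hw)).1 hw).symm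

theorem Mdl.exists_choice {a : ZFSet.{u}} (ha : a ∈ K) (hne : ∀ x, x ∈ a → ∃ y, y ∈ x)
    (hd : ∀ x, x ∈ a → ∀ y, y ∈ a → x ≠ y → ∀ z, z ∈ x → z ∉ y) :
    ∃ c, c ∈ K ∧ ∀ x, x ∈ a → ∃ y, y ∈ x ∧ y ∈ c ∧ ∀ z, z ∈ x → z ∈ c → z = y := by
  have h := hK.out.2.realize_of_mem choiceAx (by simp [ZFCTheory])
  simp [choiceAx, Sentence.Realize, Formula.Realize, realize_mem', realize_eq', Fin.snoc] at h
  obtain ⟨c, hc, h⟩ := h a ha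
    (fun x _ hx => (hne x hx).imp fun y hy => ⟨Mdl.trans K (Mdl.trans K ha hx) hy, hy⟩)
    (fun x _ y _ hx hy hxy z _ => hd x hx y hy hxy z)
  refine ⟨c, hc, fun x hx => ?_⟩
  obtain ⟨y, ⟨hyx, hyc⟩, -, h⟩ := h x (Mdl.trans K ha hx) hx
  exact ⟨y, hyx, hyc, fun z hz => h z (Mdl.trans K (Mdl.trans K ha hx) hz) hz⟩

theorem Mdl.sep_mem {P : ZFSet.{u} → Prop} (hP : D1 K P) {a : ZFSet.{u}} (ha : a ∈ K) :
    ZFSet.sep P a ∈ K := by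
  obtain ⟨k, p, φ, hφ⟩ := hP.exists_formula
  have h := hK.out.2.realize_of_mem (sepAx φ)
    (Or.inl (Or.inr (Set.mem_iUnion.2 ⟨k, φ, rfl⟩)))
  rw [Sentence.Realize, sepAx, BoundedFormula.realize_alls] at h
  have h := h p
  simp [realize_mem', BoundedFormula.realize_liftAt, Fin.snoc] at h
  obtain ⟨b, hb, h⟩ := h a ha
  convert hb
  ext x
  have hv : ∀ y : K, (Fin.snoc (Fin.snoc (Fin.snoc (α := fun _ => K) p ⟨a, ha⟩) ⟨b, hb⟩) y ∘
      fun i : Fin (k + 1) => if (i : ℕ) < k then Fin.castAdd 2 i else i.addNat 2) =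
      Fin.append p ![y] := by
    intro y
    funext i
    refine Fin.addCases (fun i => ?_) (fun i => ?_) i
    · simp [Fin.snoc]
      rw [dif_pos (by omega)]
      rfl
    · simp [Fin.snoc]
  have hx : ∀ hx : x ∈ K, x ∈ b ↔ x ∈ a ∧ P x := fun hx =>
    (h x hx).trans (and_congr_right fun _ => by erw [hv, hφ]; simp)
  rw [ZFSet.mem_sep]
  exact ⟨fun h => (hx (Mdl.trans K ha h.1)).2 h, fun h => (hx (Mdl.trans K hb h)).1 h⟩

theorem Mdl.collection {P : ZFSet.{u} → ZFSet.{u} → Prop} (hP : D2 K P) {a : ZFSet.{u}}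
    (ha : a ∈ K) :
    ∃ b, b ∈ K ∧ ∀ x, x ∈ a → (∃ y, y ∈ K ∧ P x y) → ∃ y, y ∈ b ∧ P x y := by
  obtain ⟨k, p, φ, hφ⟩ := hP.exists_formula
  have h := hK.out.2.realize_of_mem (collAx φ)
    (Or.inr (Set.mem_iUnion.2 ⟨k, φ, rfl⟩))
  rw [Sentence.Realize, collAx, BoundedFormula.realize_alls] at h
  have h := h p
  simp [realize_mem', BoundedFormula.realize_liftAt, Fin.snoc] at h
  obtain ⟨b, hb, h⟩ := h a ha
  have hv : ∀ x y : K, (Fin.snoc (Fin.snoc (Fin.snoc (Fin.snoc (α := fun _ => K) p ⟨a, ha⟩)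
      ⟨b, hb⟩) x) y ∘
      fun i : Fin (k + 2) => if (i : ℕ) < k then Fin.castAdd 2 i else i.addNat 2) =
      Fin.append p ![x, y] := by
    intro x y
    funext i
    refine Fin.addCases (fun i => ?_) (fun i => ?_) i
    · simp [Fin.snoc]
      rw [dif_pos (by omega), dif_pos (by omega)]
      rfl
    · fin_cases i <;> simp [Fin.snoc]
  refine ⟨b, hb, fun x hx ⟨y, hy, hxy⟩ => ?_⟩
  obtain ⟨z, hz, hzK, h⟩ := h x (Mdl.trans K ha hx) hx y hy (by erw [hv, hφ]; simpa)
  erw [hv, hφ] at h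
  exact ⟨z, hz, by simpa using h⟩

end axioms

end TransModel

namespace TransModel

universe u

variable {M N K : Set ZFSet.{u}} {n : ℕ}

section closed

variable [Mdl K]

theorem Mdl.empty_mem (K : Set ZFSet.{u}) [Mdl K] : ∅ ∈ K := by
  obtain ⟨x, hx, h, -⟩ := Mdl.exists_inductive K
  exact Mdl.trans K hx h

theorem Mdl.union_mem {x y : ZFSet.{u}} (hx : x ∈ K) (hy : y ∈ K) : x ∪ y ∈ K :=
  Mdl.sUnion_mem (Mdl.pair_mem hx hy)

theorem Mdl.insert_mem {x y : ZFSet.{u}} (hx : x ∈ K) (hy : y ∈ K) : insert x y ∈ K := by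
  convert Mdl.union_mem (Mdl.pair_mem hx hx) hy
  ext
  simp

theorem pair_eq_insert (x y : ZFSet.{u}) : ZFSet.pair x y =
    insert (insert x ∅) (insert (insert x (insert y ∅)) ∅) := by
  simp [ZFSet.pair]

theorem Mdl.opair_mem {x y : ZFSet.{u}} (hx : x ∈ K) (hy : y ∈ K) : x.pair y ∈ K :=
  Mdl.pair_mem (by simpa using Mdl.pair_mem hx hx) (Mdl.pair_mem hx hy)

theorem Mdl.of_opair {x y f : ZFSet.{u}} (hf : f ∈ K) (h : x.pair y ∈ f) : x ∈ K ∧ y ∈ K := by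
  have h := Mdl.trans K hf h
  have h : {x, y} ∈ K := Mdl.trans K h (by simp [ZFSet.pair])
  exact ⟨Mdl.trans K h (by simp), Mdl.trans K h (by simp)⟩

/-- The power set in the sense of `K`. -/
noncomputable def pow (K : Set ZFSet.{u}) (x : ZFSet.{u}) : ZFSet.{u} :=
  ZFSet.sep (fun z => z ∈ K) (ZFSet.powerset x)

omit [Mdl K] in
theorem mem_pow {x z : ZFSet.{u}} : z ∈ pow K x ↔ z ⊆ x ∧ z ∈ K := by
  simp [pow]

theorem Mdl.pow_mem {x : ZFSet.{u}} (hx : x ∈ K) : pow K x ∈ K := by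
  obtain ⟨y, hy, h⟩ := Mdl.exists_powerset hx
  convert hy
  ext z
  rw [mem_pow]
  exact ⟨fun hz => (h z hz.2).2 hz.1, fun hz => ⟨(h z (Mdl.trans K hy hz)).1 hz, Mdl.trans K hy hz⟩⟩

end closed

section operations

variable {j : M → N} {t s t' s' t'' s'' : (Fin n → ZFSet.{u}) → ZFSet.{u}}

theorem Tr.of_iff {P P' : (Fin n → ZFSet.{u}) → Prop} (h : Tr j P' P') (e : ∀ v, P v ↔ P' v) :
    Tr j P P :=
  Tr.congr h (fun _ => (e _).symm) fun _ => (e _).symm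

theorem Tm.op1 {F G : ZFSet.{u} → ZFSet.{u}} (hM : ∀ x ∈ M, F x ∈ M) (hN : ∀ x ∈ N, G x ∈ N)
    (h : Tr j (fun w : Fin 2 → ZFSet.{u} => w 1 = F (w 0)) fun w => w 1 = G (w 0))
    (ht : Tm j t s) : Tm j (fun v => F (t v)) fun v => G (s v) :=
  ⟨fun v => hM _ (ht.memL v), fun v => hN _ (ht.memR v),
    Tr.subst2 (P := fun x y => y = F x) (Q := fun x y => y = G x) h ht.weaken (Tm.var _)⟩

theorem Tm.op2 {F G : ZFSet.{u} → ZFSet.{u} → ZFSet.{u}} (hM : ∀ x ∈ M, ∀ y ∈ M, F x y ∈ M)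
    (hN : ∀ x ∈ N, ∀ y ∈ N, G x y ∈ N)
    (h : Tr j (fun w : Fin 3 → ZFSet.{u} => w 2 = F (w 0) (w 1)) fun w => w 2 = G (w 0) (w 1))
    (ht : Tm j t s) (ht' : Tm j t' s') :
    Tm j (fun v => F (t v) (t' v)) fun v => G (s v) (s' v) :=
  ⟨fun v => hM _ (ht.memL v) _ (ht'.memL v), fun v => hN _ (ht.memR v) _ (ht'.memR v),
    Tr.subst3 (P := fun x y z => z = F x y) (Q := fun x y z => z = G x y) h
      ht.weaken ht'.weaken (Tm.var _)⟩

variable [Mdl M] [Mdl N]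

instance Tm.op_empty : Tm j (fun _ : Fin n → ZFSet.{u} => ∅) (fun _ => ∅) :=
  ⟨fun _ => Mdl.empty_mem M, fun _ => Mdl.empty_mem N,
    Tr.of_iff (P' := fun w => ∀ x, x ∈ w (Fin.last n) → ¬ x = x) inferInstance fun w => by
      rw [ZFSet.eq_empty]; simp⟩

instance Tr.subset [ht : Tm j t s] [ht' : Tm j t' s'] :
    Tr j (fun v => t v ⊆ t' v) fun v => s v ⊆ s' v :=
  Tr.subst2 (P := fun x y => x ⊆ y) (Q := fun x y => x ⊆ y)
    (Tr.of_iff (P' := fun w => ∀ x, x ∈ w 0 → x ∈ w 1) inferInstance fun _ => Iff.rfl) ht ht'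

instance Tm.op_insert [ht : Tm j t s] [ht' : Tm j t' s'] :
    Tm j (fun v => insert (t v) (t' v)) fun v => insert (s v) (s' v) :=
  Tm.op2 (F := Insert.insert) (G := Insert.insert) (fun _ hx _ hy => Mdl.insert_mem hx hy)
    (fun _ hx _ hy => Mdl.insert_mem hx hy)
    (Tr.of_iff (P' := fun w => w 1 ⊆ w 2 ∧ w 0 ∈ w 2 ∧ ∀ x, x ∈ w 2 → x = w 0 ∨ x ∈ w 1)
      inferInstance fun w => by
        constructor
        · intro h
          rw [h]
          exact ⟨fun x hx => by simp [hx], by simp, fun x hx => by simpa using hx⟩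
        · rintro ⟨h1, h2, h3⟩
          ext x
          rw [ZFSet.mem_insert_iff]
          refine ⟨h3 x, ?_⟩
          rintro (rfl | h)
          exacts [h2, h1 h]) ht ht'

instance Tm.op_opair [ht : Tm j t s] [ht' : Tm j t' s'] :
    Tm j (fun v => ZFSet.pair (t v) (t' v)) fun v => ZFSet.pair (s v) (s' v) := by
  simp only [pair_eq_insert]
  infer_instance

instance Tm.op_sUnion [ht : Tm j t s] :
    Tm j (fun v => ZFSet.sUnion (t v)) fun v => ZFSet.sUnion (s v) :=
  Tm.op1 (F := ZFSet.sUnion) (G := ZFSet.sUnion) (fun _ hx => Mdl.sUnion_mem hx)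
    (fun _ hx => Mdl.sUnion_mem hx)
    (Tr.of_iff (P' := fun w => (∀ x, x ∈ w 0 → x ⊆ w 1) ∧ ∀ x, x ∈ w 1 → ∃ y, y ∈ w 0 ∧ x ∈ y)
      inferInstance fun w => by
        constructor
        · intro h
          rw [h]
          exact ⟨fun x hx z hz => ZFSet.mem_sUnion.2 ⟨x, hx, hz⟩, fun x hx => ZFSet.mem_sUnion.1 hx⟩
        · rintro ⟨h1, h2⟩
          ext x
          rw [ZFSet.mem_sUnion]
          exact ⟨h2 x, fun ⟨y, hy, hx⟩ => h1 y hy hx⟩) ht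

instance Tm.op_pow [ht : Tm j t s] : Tm j (fun v => pow M (t v)) fun v => pow N (s v) :=
  Tm.op1 (fun _ hx => Mdl.pow_mem hx) (fun _ hx => Mdl.pow_mem hx)
    (Tr.congr (n := 2) (P := fun w => ∀ x, x ∈ M → (x ∈ w 1 ↔ x ⊆ w 0))
      (Q := fun w => ∀ x, x ∈ N → (x ∈ w 1 ↔ x ⊆ w 0)) inferInstance
      (fun v => by
        constructor
        · intro h
          exact Mdl.ext_mem M (v 1).2 (Mdl.pow_mem (v 0).2) fun z hz => by
            simp [h z hz, mem_pow, hz]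
        · intro h x hx
          rw [h, mem_pow]
          simp [hx])
      fun v => by
        constructor
        · intro h
          exact Mdl.ext_mem N (v 1).2 (Mdl.pow_mem (v 0).2) fun z hz => by
            simp [h z hz, mem_pow, hz]
        · intro h x hx
          rw [h, mem_pow]
          simp [hx]) ht

instance Tr.isOrdinal [ht : Tm j t s] :
    Tr j (fun v => (t v).IsOrdinal) fun v => (s v).IsOrdinal :=
  Tr.subst1 (P := fun x => x.IsOrdinal) (Q := fun x => x.IsOrdinal)
    (Tr.of_iff (P' := fun w => (∀ y, y ∈ w 0 → y ⊆ w 0) ∧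
      ∀ x, x ∈ w 0 → ∀ y, y ∈ x → ∀ z, z ∈ y → z ∈ x) inferInstance fun _ =>
      ⟨fun h => ⟨fun y hy => h.isTransitive y hy,
        fun _ hx _ hy _ hz => (h.mem hx).isTransitive.mem_trans hz hy⟩,
       fun h => ⟨h.1, fun hyz hzx hx => h.2 _ hx _ hzx _ hyz⟩⟩) ht

theorem isFunc_iff {x y f : ZFSet.{u}} : ZFSet.IsFunc x y f ↔
    (∀ p, p ∈ f → ∃ a, a ∈ x ∧ ∃ b, b ∈ y ∧ p = a.pair b) ∧
      ∀ a, a ∈ x → ∃ b, b ∈ y ∧ (a.pair b ∈ f ∧ ∀ c, c ∈ y → a.pair c ∈ f → c = b) := by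
  have e : f ⊆ x.prod y ↔ ∀ p, p ∈ f → ∃ a, a ∈ x ∧ ∃ b, b ∈ y ∧ p = a.pair b :=
    forall₂_congr fun p _ => by simp [ZFSet.mem_prod]
  rw [ZFSet.IsFunc, ← e]
  refine and_congr_right fun h => forall₂_congr fun a _ => ?_
  constructor
  · rintro ⟨b, hb, h'⟩
    exact ⟨b, (ZFSet.pair_mem_prod.1 (h hb)).2, hb, fun c _ => h' c⟩
  · rintro ⟨b, hby, hb, h'⟩
    exact ⟨b, hb, fun c hc => h' c (ZFSet.pair_mem_prod.1 (h hc)).2 hc⟩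

instance Tr.isFunc [ht : Tm j t s] [ht' : Tm j t' s'] [ht'' : Tm j t'' s''] :
    Tr j (fun v => ZFSet.IsFunc (t v) (t' v) (t'' v))
      fun v => ZFSet.IsFunc (s v) (s' v) (s'' v) := by
  simp only [isFunc_iff]
  refine Tr.subst3 (P := fun x y f => (∀ p, p ∈ f → ∃ a, a ∈ x ∧ ∃ b, b ∈ y ∧ p = a.pair b) ∧
      ∀ a, a ∈ x → ∃ b, b ∈ y ∧ (a.pair b ∈ f ∧ ∀ c, c ∈ y → a.pair c ∈ f → c = b))
      (Q := fun x y f => (∀ p, p ∈ f → ∃ a, a ∈ x ∧ ∃ b, b ∈ y ∧ p = a.pair b) ∧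
      ∀ a, a ∈ x → ∃ b, b ∈ y ∧ (a.pair b ∈ f ∧ ∀ c, c ∈ y → a.pair c ∈ f → c = b)) ?_ ht ht' ht''
  infer_instance

instance Tr.cofinalIn [ht : Tm j t s] [ht' : Tm j t' s'] [ht'' : Tm j t'' s''] :
    Tr j (fun v => CofinalIn (t v) (t' v) (t'' v)) fun v => CofinalIn (s v) (s' v) (s'' v) :=
  Tr.subst3 (P := CofinalIn) (Q := CofinalIn)
    (Tr.congr (n := 3) (P := fun w => ∀ γ, γ ∈ w 1 → ∃ ξ, ξ ∈ w 0 ∧ ∃ η, η ∈ M ∧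
        (ξ.pair η ∈ w 2 ∧ (γ ∈ η ∨ γ = η)))
      (Q := fun w => ∀ γ, γ ∈ w 1 → ∃ ξ, ξ ∈ w 0 ∧ ∃ η, η ∈ N ∧
        (ξ.pair η ∈ w 2 ∧ (γ ∈ η ∨ γ = η))) inferInstance
      (fun v => forall₂_congr fun _ _ => exists_congr fun _ => and_congr_right fun _ =>
        exists_congr fun _ => ⟨fun h => h.2, fun h => ⟨(Mdl.of_opair (v 2).2 h.1).2, h⟩⟩)
      fun v => forall₂_congr fun _ _ => exists_congr fun _ => and_congr_right fun _ =>
        exists_congr fun _ => ⟨fun h => h.2, fun h => ⟨(Mdl.of_opair (v 2).2 h.1).2, h⟩⟩)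
    ht ht' ht''

instance Tr.regularIn [ht : Tm j t s] :
    Tr j (fun v => RegularIn M (t v)) fun v => RegularIn N (s v) :=
  Tr.subst1 (P := RegularIn M) (Q := RegularIn N)
    (inferInstanceAs (Tr j (fun w : Fin 1 → ZFSet.{u} => ∀ β, β ∈ w 0 → ∀ f, f ∈ M →
      ZFSet.IsFunc β (w 0) f → ¬ CofinalIn β (w 0) f) fun w => ∀ β, β ∈ w 0 → ∀ f, f ∈ N →
      ZFSet.IsFunc β (w 0) f → ¬ CofinalIn β (w 0) f)) ht

end operations

section omega

/-- The finite von Neumann ordinals. -/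
noncomputable def nat (n : ℕ) : ZFSet.{u} :=
  ZFSet.mk (PSet.ofNat n)

theorem nat_zero : nat.{u} 0 = ∅ :=
  rfl

theorem nat_succ (n : ℕ) : nat.{u} (n + 1) = insert (nat n) (nat n) :=
  rfl

theorem mem_omega_iff {x : ZFSet.{u}} : x ∈ ZFSet.omega ↔ ∃ n, x = nat n := by
  induction x using Quotient.inductionOn with
  | h x => exact ⟨fun ⟨⟨n⟩, h⟩ => ⟨n, ZFSet.sound h⟩, fun ⟨n, h⟩ => ⟨⟨n⟩, ZFSet.exact h⟩⟩

theorem nat_mem_omega (n : ℕ) : nat.{u} n ∈ ZFSet.omega :=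
  mem_omega_iff.2 ⟨n, rfl⟩

theorem isOrdinal_nat (n : ℕ) : (nat.{u} n).IsOrdinal := by
  induction n with
  | zero => exact ZFSet.isOrdinal_empty
  | succ n ih => exact ZFSet.isOrdinal_succ ih

theorem isOrdinal_omega : ZFSet.omega.{u}.IsOrdinal := by
  rw [ZFSet.isOrdinal_iff_forall_mem_isOrdinal]
  constructor
  · intro x hx
    obtain ⟨n, rfl⟩ := mem_omega_iff.1 hx
    clear hx
    induction n with
    | zero => simp [nat_zero]
    | succ n ih =>
      intro y hy
      rw [nat_succ, ZFSet.mem_insert_iff] at hy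
      rcases hy with rfl | hy
      exacts [nat_mem_omega n, ih hy]
  · intro x hx
    obtain ⟨n, rfl⟩ := mem_omega_iff.1 hx
    exact isOrdinal_nat n

theorem Mdl.omega_mem (K : Set ZFSet.{u}) [Mdl K] : ZFSet.omega ∈ K := by
  obtain ⟨a, ha, h0, h1⟩ := Mdl.exists_inductive K
  have hD : D1 K fun x => ∀ y, y ∈ K → ∅ ∈ y → (∀ z, z ∈ y → insert z z ∈ y) → x ∈ y :=
    inferInstance
  have hb := Mdl.sep_mem hD ha
  set b := ZFSet.sep _ a with hb'
  have hb0 : ∅ ∈ b := ZFSet.mem_sep.2 ⟨h0, fun y _ h _ => h⟩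
  have hb1 : ∀ z, z ∈ b → insert z z ∈ b := fun z hz => by
    rw [hb', ZFSet.mem_sep] at hz ⊢
    exact ⟨h1 z hz.1, fun y hy h h' => h' z (hz.2 y hy h h')⟩
  clear_value b
  convert hb
  ext z
  constructor
  · intro hz
    obtain ⟨n, rfl⟩ := mem_omega_iff.1 hz
    induction n with
    | zero => exact hb0
    | succ n ih => exact hb1 _ (ih (nat_mem_omega n))
  · induction z using ZFSet.inductionOn with
    | _ z ih =>
    intro hz
    lift b to K using hb
    have hD : D1 K fun x => x = ∅ ∨ ∃ y, y ∈ (b : ZFSet) ∧ x = insert y y := inferInstance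
    rw [hb', ZFSet.mem_sep] at hz
    have h := hz.2 _ (Mdl.sep_mem hD b.2) (by simp [hb0]) (by
      intro z hz
      rw [ZFSet.mem_sep] at hz ⊢
      exact ⟨hb1 z hz.1, Or.inr ⟨z, hz.1, rfl⟩⟩)
    rcases (ZFSet.mem_sep.1 h).2 with rfl | ⟨y, hy, rfl⟩
    · exact ZFSet.omega_zero
    · exact ZFSet.omega_succ (ih y (by simp) hy)

instance Tm.op_omega [Mdl M] [Mdl N] {j : M → N} :
    Tm j (fun _ : Fin n → ZFSet.{u} => ZFSet.omega) (fun _ => ZFSet.omega) :=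
  ⟨fun _ => Mdl.omega_mem M, fun _ => Mdl.omega_mem N,
    Tr.of_iff (P' := fun w => ∅ ∈ w (Fin.last n) ∧
        (∀ x, x ∈ w (Fin.last n) → insert x x ∈ w (Fin.last n)) ∧
        ∀ x, x ∈ w (Fin.last n) → x = ∅ ∨ ∃ y, y ∈ w (Fin.last n) ∧ x = insert y y)
      inferInstance fun w => by
        constructor
        · intro h
          rw [h]
          refine ⟨ZFSet.omega_zero, fun x hx => ZFSet.omega_succ hx, fun x hx => ?_⟩
          obtain ⟨_ | n, rfl⟩ := mem_omega_iff.1 hx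
          exacts [Or.inl rfl, Or.inr ⟨nat n, nat_mem_omega n, rfl⟩]
        · rintro ⟨h0, h1, h2⟩
          ext z
          constructor
          · induction z using ZFSet.inductionOn with
            | _ z ih =>
            intro hz
            rcases h2 z hz with rfl | ⟨y, hy, rfl⟩
            · exact ZFSet.omega_zero
            · exact ZFSet.omega_succ (ih y (by simp) hy)
          · intro hz
            obtain ⟨n, rfl⟩ := mem_omega_iff.1 hz
            induction n with
            | zero => exact h0
            | succ n ih => exact h1 _ (ih (nat_mem_omega n))⟩

end omega

end TransModel

namespace TransModel

universe u

variable {M N K : Set ZFSet.{u}} {n : ℕ} {t t' : (Fin n → ZFSet.{u}) → ZFSet.{u}}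

theorem D2.app {R : ZFSet.{u} → ZFSet.{u} → Prop} (h : D2 K R) {n : ℕ}
    {t t' : (Fin n → ZFSet.{u}) → ZFSet.{u}} [ht : Tm (fun x : K => x) t t]
    [ht' : Tm (fun x : K => x) t' t'] : Df K fun v => R (t v) (t' v) :=
  Tr.subst2 h ht ht'

theorem exists_least {P : ZFSet.{u} → Prop} {α : ZFSet.{u}} (hα : α.IsOrdinal) (h : P α) :
    ∃ β, β.IsOrdinal ∧ P β ∧ (β = α ∨ β ∈ α) ∧ ∀ γ, γ ∈ β → ¬ P γ := by
  induction α using ZFSet.inductionOn with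
  | _ α ih =>
  by_cases h' : ∃ γ, γ ∈ α ∧ P γ
  · obtain ⟨γ, hγ, hP⟩ := h'
    obtain ⟨β, h1, h2, h3, h4⟩ := ih γ hγ (hα.mem hγ) hP
    refine ⟨β, h1, h2, Or.inr ?_, h4⟩
    rcases h3 with rfl | h3
    exacts [hγ, hα.mem_trans h3 hγ]
  · push Not at h'
    exact ⟨α, hα, h, Or.inl rfl, h'⟩

theorem exists_recursive (G : (ZFSet.{u} → Prop) → ZFSet.{u}) :
    ∃ H : ZFSet.{u} → ZFSet.{u}, ∀ ξ, H ξ = G fun w => ∃ ζ, ζ ∈ ξ ∧ w = H ζ := by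
  refine ⟨ZFSet.mem_wf.fix fun ξ ih => G fun w => ∃ ζ, ∃ h : ζ ∈ ξ, w = ih ζ h, fun ξ => ?_⟩
  rw [WellFounded.fix_eq]
  simp only [exists_prop]

variable [Mdl K]

theorem Mdl.replacement {R : ZFSet.{u} → ZFSet.{u} → Prop} (hR : D2 K R) {a : ZFSet.{u}}
    (ha : a ∈ K) (hu : ∀ x ∈ a, ∀ y ∈ K, ∀ y' ∈ K, R x y → R x y' → y = y') :
    ∃ b, b ∈ K ∧ ∀ y, y ∈ b ↔ y ∈ K ∧ ∃ x, x ∈ a ∧ R x y := by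
  obtain ⟨b, hb, h⟩ := Mdl.collection hR ha
  have hR' := @D2.app K R hR
  lift a to K using ha
  have hD : D1 K fun y => ∃ x, x ∈ (a : ZFSet) ∧ R x y := inferInstance
  refine ⟨_, Mdl.sep_mem hD hb, fun y => ?_⟩
  rw [ZFSet.mem_sep]
  constructor
  · exact fun hy => ⟨Mdl.trans K hb hy.1, hy.2⟩
  · rintro ⟨hy, x, hx, hxy⟩
    obtain ⟨z, hz, hxz⟩ := h x hx ⟨y, hy, hxy⟩
    rw [hu x hx y hy z (Mdl.trans K hb hz) hxy hxz]
    exact ⟨hz, x, hx, hxz⟩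

/-- `f` is single-valued as a set of ordered pairs. -/
def Fn (f : ZFSet.{u}) : Prop :=
  ∀ x y z : ZFSet.{u}, x.pair y ∈ f → x.pair z ∈ f → y = z

/-- The set of values of `f` on `a`, in the model. -/
theorem Mdl.exists_image {f a : ZFSet.{u}} (hf : f ∈ K) (ha : a ∈ K) :
    ∃ b, b ∈ K ∧ ∀ y, y ∈ b ↔ ∃ x, x ∈ a ∧ x.pair y ∈ f := by
  lift a to K using ha
  lift f to K using hf
  have hD : D1 K fun y => ∃ x, x ∈ (a : ZFSet) ∧ x.pair y ∈ (f : ZFSet) := inferInstance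
  refine ⟨_, Mdl.sep_mem hD (Mdl.sUnion_mem (Mdl.sUnion_mem f.2)), fun y => ?_⟩
  rw [ZFSet.mem_sep, and_iff_right_iff_imp]
  rintro ⟨x, -, h⟩
  exact ZFSet.mem_sUnion.2 ⟨{x, y}, ZFSet.mem_sUnion.2 ⟨_, h, by simp [ZFSet.pair]⟩, by simp⟩

theorem Mdl.prod_mem {a b : ZFSet.{u}} (ha : a ∈ K) (hb : b ∈ K) : a.prod b ∈ K := by
  lift a to K using ha
  lift b to K using hb
  have hD : D1 K fun p => ∃ x, x ∈ (a : ZFSet) ∧ ∃ y, y ∈ (b : ZFSet) ∧ p = x.pair y :=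
    inferInstance
  convert Mdl.sep_mem hD (Mdl.pow_mem (Mdl.pow_mem (Mdl.union_mem a.2 b.2)))
  ext p
  rw [ZFSet.mem_prod, ZFSet.mem_sep]
  constructor
  · rintro ⟨x, hx, y, hy, rfl⟩
    have hxK := Mdl.trans K a.2 hx
    have hyK := Mdl.trans K b.2 hy
    refine ⟨mem_pow.2 ⟨fun z hz => mem_pow.2 ?_, Mdl.opair_mem hxK hyK⟩, x, hx, y, hy, rfl⟩
    refine ⟨fun w hw => ?_, Mdl.trans K (Mdl.opair_mem hxK hyK) hz⟩
    rw [ZFSet.mem_union]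
    rw [ZFSet.pair, ZFSet.mem_pair] at hz
    rcases hz with rfl | rfl
    · exact Or.inl (ZFSet.mem_singleton.1 hw ▸ hx)
    · rcases ZFSet.mem_pair.1 hw with rfl | rfl
      exacts [Or.inl hx, Or.inr hy]
  · exact fun h => h.2

theorem Mdl.uniformization {R : ZFSet.{u} → ZFSet.{u} → Prop} (hR : D2 K R) {a : ZFSet.{u}}
    (ha : a ∈ K) (h : ∀ x ∈ a, ∃ y, y ∈ K ∧ R x y) :
    ∃ f, f ∈ K ∧ Fn f ∧ (∀ x ∈ a, ∃ y, x.pair y ∈ f) ∧ ∀ x y, x.pair y ∈ f → x ∈ a ∧ R x y := by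
  obtain ⟨b, hb, hab⟩ := Mdl.collection hR ha
  have hR' := @D2.app K R hR
  lift a to K using ha
  lift b to K using hb
  have hD : D2 K fun x s => ∀ p, p ∈ K → (p ∈ s ↔ ∃ y, y ∈ (b : ZFSet) ∧ R x y ∧ p = x.pair y) :=
    inferInstance
  obtain ⟨A, hA, hA'⟩ := Mdl.replacement hD a.2 fun x hx y hy y' hy' h h' =>
    Mdl.ext_mem K hy hy' fun z hz => (h z hz).trans (h' z hz).symm
  have hS : ∀ x ∈ (a : ZFSet), ∃ s, s ∈ A ∧
      ∀ p, p ∈ K → (p ∈ s ↔ ∃ y, y ∈ (b : ZFSet) ∧ R x y ∧ p = x.pair y) := by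
    intro x hx
    lift x to K using Mdl.trans K a.2 hx
    have hD : D1 K fun p => ∃ y, y ∈ (b : ZFSet) ∧ R x y ∧ p = (x : ZFSet).pair y := inferInstance
    have hs := Mdl.sep_mem hD (Mdl.prod_mem a.2 b.2)
    have : ∀ p, p ∈ K → (p ∈ ZFSet.sep (fun p => ∃ y, y ∈ (b : ZFSet) ∧ R x y ∧
        p = (x : ZFSet).pair y) (ZFSet.prod a b) ↔ ∃ y, y ∈ (b : ZFSet) ∧ R x y ∧
        p = (x : ZFSet).pair y) := by
      intro p _
      rw [ZFSet.mem_sep, and_iff_right_iff_imp]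
      rintro ⟨y, hy, -, rfl⟩
      exact ZFSet.pair_mem_prod.2 ⟨hx, hy⟩
    exact ⟨_, (hA' _).2 ⟨hs, x, hx, this⟩, this⟩
  obtain ⟨c, hc, hc'⟩ := Mdl.exists_choice hA (by
      intro s hs
      obtain ⟨hsK, x, hx, h'⟩ := (hA' s).1 hs
      obtain ⟨y, hy, hxy⟩ := hab x hx (h x hx)
      have := Mdl.opair_mem (Mdl.trans K a.2 hx) (Mdl.trans K b.2 hy)
      exact ⟨x.pair y, (h' _ this).2 ⟨y, hy, hxy, rfl⟩⟩) (by
      intro s hs s' hs' hne p hp hp'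
      obtain ⟨hsK, x, hx, h1⟩ := (hA' s).1 hs
      obtain ⟨hsK', x', hx', h2⟩ := (hA' s').1 hs'
      obtain ⟨y, hy, -, rfl⟩ := (h1 p (Mdl.trans K hsK hp)).1 hp
      obtain ⟨y', hy', -, he⟩ := (h2 _ (Mdl.trans K hsK hp)).1 hp'
      obtain ⟨rfl, rfl⟩ := ZFSet.pair_inj.1 he
      exact hne (Mdl.ext_mem K hsK hsK' fun p hp => (h1 p hp).trans (h2 p hp).symm))
  lift c to K using hc
  have hD : D1 K fun p => p ∈ (c : ZFSet) ∧ ∃ x, x ∈ (a : ZFSet) ∧ ∃ y, y ∈ (b : ZFSet) ∧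
    R x y ∧ p = x.pair y := inferInstance
  have hf := Mdl.sep_mem hD (Mdl.prod_mem a.2 b.2)
  have hm : ∀ x y, x.pair y ∈ ZFSet.sep (fun p => p ∈ (c : ZFSet) ∧ ∃ x, x ∈ (a : ZFSet) ∧
      ∃ y, y ∈ (b : ZFSet) ∧ R x y ∧ p = x.pair y) (ZFSet.prod a b) ↔
      x.pair y ∈ (c : ZFSet) ∧ x ∈ (a : ZFSet) ∧ y ∈ (b : ZFSet) ∧ R x y := by
    intro x y
    rw [ZFSet.mem_sep, ZFSet.pair_mem_prod]
    constructor
    · rintro ⟨h1, h2, x', hx', y', hy', h3, h4⟩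
      obtain ⟨rfl, rfl⟩ := ZFSet.pair_inj.1 h4
      exact ⟨h2, h1.1, h1.2, h3⟩
    · rintro ⟨h1, h2, h3, h4⟩
      exact ⟨⟨h2, h3⟩, h1, x, h2, y, h3, h4, rfl⟩
  refine ⟨_, hf, fun x y z hy hz => ?_, fun x hx => ?_, fun x y hxy => ?_⟩
  · rw [hm] at hy hz
    obtain ⟨s, hs, hs'⟩ := hS x hy.2.1
    obtain ⟨p, -, -, hp⟩ := hc' s hs
    have e1 := hp _ ((hs' _ (Mdl.trans K c.2 hy.1)).2 ⟨y, hy.2.2.1, hy.2.2.2, rfl⟩) hy.1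
    have e2 := hp _ ((hs' _ (Mdl.trans K c.2 hz.1)).2 ⟨z, hz.2.2.1, hz.2.2.2, rfl⟩) hz.1
    exact (ZFSet.pair_inj.1 (e1.trans e2.symm)).2
  · obtain ⟨s, hs, hs'⟩ := hS x hx
    obtain ⟨p, hp, hpc, -⟩ := hc' s hs
    obtain ⟨y, hy, hxy, rfl⟩ := (hs' p (Mdl.trans K c.2 hpc)).1 hp
    exact ⟨y, (hm _ _).2 ⟨hpc, hx, hy, hxy⟩⟩
  · rw [hm] at hxy
    exact ⟨hxy.2.1, hxy.2.2.2⟩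

/-- Definable recursion along ordinals for an externally given function, with a defining relation
independent of the length of the recursion. -/
theorem Mdl.exists_recursion_rel {Γ : ZFSet.{u} → ZFSet.{u} → Prop} (hΓ : D2 K Γ)
    (H : ZFSet.{u} → ZFSet.{u}) :
    ∃ R : ZFSet.{u} → ZFSet.{u} → Prop, D2 K R ∧ ∀ α, α.IsOrdinal → α ∈ K →
      (∀ ξ ∈ α, ∀ u ∈ K, (∀ w, w ∈ u ↔ ∃ ζ, ζ ∈ ξ ∧ w = H ζ) →
        H ξ ∈ K ∧ ∀ y ∈ K, Γ u y ↔ y = H ξ) →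
      (∀ ξ ∈ α, ∀ y ∈ K, R ξ y ↔ y = H ξ) ∧
        ∃ f, f ∈ K ∧ ∀ ζ y, ζ.pair y ∈ f ↔ ζ ∈ α ∧ y = H ζ := by
  have hΓ' := @D2.app K Γ hΓ
  let Att (f ζ : ZFSet.{u}) : Prop := ∀ η, η ∈ ζ → ∃ y, y ∈ K ∧
    ((∀ w, w ∈ K → (η.pair w ∈ f ↔ w = y)) ∧ ∃ u, u ∈ K ∧
      ((∀ w, w ∈ K → (w ∈ u ↔ ∃ z, z ∈ η ∧ z.pair w ∈ f)) ∧ Γ u y))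
  let R (ζ y : ZFSet.{u}) : Prop := ∃ f, f ∈ K ∧ (Att f ζ ∧ ∃ u, u ∈ K ∧
    ((∀ w, w ∈ K → (w ∈ u ↔ ∃ z, z ∈ ζ ∧ z.pair w ∈ f)) ∧ Γ u y))
  have hR : D2 K R := by
    unfold R Att
    infer_instance
  refine ⟨R, hR, fun α hα hαK hH => ?_⟩
  have val : ∀ f ∈ K, ∀ η ∈ α, (∀ z ∈ η, ∀ w, z.pair w ∈ f ↔ w = H z) → ∀ u ∈ K,
      (∀ w, w ∈ K → (w ∈ u ↔ ∃ z, z ∈ η ∧ z.pair w ∈ f)) → H η ∈ K ∧ ∀ y ∈ K, Γ u y ↔ y = H η := by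
    intro f hf η hη h u hu hw
    refine hH η hη u hu fun w => ⟨fun h' => ?_, ?_⟩
    · obtain ⟨z, hz, h''⟩ := (hw w (Mdl.trans K hu h')).1 h'
      exact ⟨z, hz, (h z hz w).1 h''⟩
    · rintro ⟨z, hz, rfl⟩
      have := (h z hz _).2 rfl
      exact (hw _ (Mdl.of_opair hf this).2).2 ⟨z, hz, this⟩
  have key : ∀ f ∈ K, ∀ ζ, ζ ⊆ α → (∀ η, η ∈ ζ → η ⊆ ζ) → Att f ζ →
      ∀ η, η ∈ ζ → ∀ w, η.pair w ∈ f ↔ w = H η := by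
    intro f hf ζ hζ ht hA η
    induction η using ZFSet.inductionOn with
    | _ η ih =>
    intro hη
    obtain ⟨y, hy, h1, u, hu, h2, h3⟩ := hA η hη
    have h4 := val f hf η (hζ hη) (fun z hz => ih z hz (ht η hη hz)) u hu h2
    obtain rfl := (h4.2 y hy).1 h3
    exact fun w => ⟨fun h => (h1 w (Mdl.of_opair hf h).2).1 h, fun h => (h1 w (h ▸ hy)).2 h⟩
  have step : ∀ ξ, ξ ⊆ α → ξ ∈ K →
      (∀ ζ, ζ ∈ ξ → ∃ f, f ∈ K ∧ ∀ η y, η.pair y ∈ f ↔ η ∈ ζ ∧ y = H η) →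
      (∀ ζ ∈ ξ, ∀ y ∈ K, R ζ y ↔ y = H ζ) ∧
        ∃ f, f ∈ K ∧ ∀ ζ y, ζ.pair y ∈ f ↔ ζ ∈ ξ ∧ y = H ζ := by
    intro ξ hξα hξ ih
    have hRH : ∀ ζ ∈ ξ, H ζ ∈ K ∧ ∀ y ∈ K, R ζ y ↔ y = H ζ := by
      intro ζ hζ
      obtain ⟨f, hf, hfH⟩ := ih ζ hζ
      have hζo := hα.mem (hξα hζ)
      have im : ∀ η ∈ K, ∃ u, u ∈ K ∧ ∀ w, w ∈ K → (w ∈ u ↔ ∃ z, z ∈ η ∧ z.pair w ∈ f) :=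
        fun η hη => let ⟨u, hu, h⟩ := Mdl.exists_image hf hη; ⟨u, hu, fun w _ => h w⟩
      obtain ⟨u, hu, hu'⟩ := im ζ (Mdl.trans K hξ hζ)
      have hv := val f hf ζ (hξα hζ) (fun z hz w => by simp [hfH, hz]) u hu hu'
      refine ⟨hv.1, fun y hy => ⟨?_, ?_⟩⟩
      · rintro ⟨g, hg, hA, u', hu', h1, h2⟩
        exact ((val g hg ζ (hξα hζ) (key g hg ζ (hα.subset_of_mem (hξα hζ))
          (fun η hη => hζo.subset_of_mem hη) hA) u' hu' h1).2 y hy).1 h2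
      · rintro rfl
        refine ⟨f, hf, fun η hη => ?_, u, hu, hu', (hv.2 _ hy).2 rfl⟩
        have hηα := hα.mem_trans hη (hξα hζ)
        obtain ⟨u, hu, hu'⟩ := im η (Mdl.trans K hαK hηα)
        have hv := val f hf η hηα (fun z hz w => by simp [hfH, hζo.mem_trans hz hη]) u hu hu'
        exact ⟨H η, hv.1, fun w _ => by simp [hfH, hη], u, hu, hu', (hv.2 _ hv.1).2 rfl⟩
    have hR' := @D2.app K R hR
    have hD : D2 K fun ζ p => ∃ y, y ∈ K ∧ (p = ζ.pair y ∧ R ζ y) := inferInstance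
    obtain ⟨f, hf, h⟩ := Mdl.replacement hD hξ (by
      rintro ζ hζ p - p' - ⟨y, hy, rfl, h⟩ ⟨y', hy', rfl, h'⟩
      rw [((hRH ζ hζ).2 y hy).1 h, ((hRH ζ hζ).2 y' hy').1 h'])
    refine ⟨fun ζ hζ => (hRH ζ hζ).2, f, hf, fun ζ y => ?_⟩
    rw [h]
    constructor
    · rintro ⟨-, ζ', hζ', y', hy', he, h'⟩
      obtain ⟨rfl, rfl⟩ := ZFSet.pair_inj.1 he
      exact ⟨hζ', ((hRH _ hζ').2 _ hy').1 h'⟩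
    · rintro ⟨hζ, rfl⟩
      have := (hRH ζ hζ).1
      exact ⟨Mdl.opair_mem (Mdl.trans K hξ hζ) this, ζ, hζ, _, this, rfl,
        ((hRH ζ hζ).2 _ this).2 rfl⟩
  refine step α (fun _ h => h) hαK fun ζ => ?_
  induction ζ using ZFSet.inductionOn with
  | _ ζ ih =>
  exact fun hζ => step ζ (hα.subset_of_mem hζ) (Mdl.trans K hαK hζ)
    (fun η hη => ih η hη (hα.mem_trans hη hζ)) |>.2

theorem Mdl.recursion {Γ : ZFSet.{u} → ZFSet.{u} → Prop} (hΓ : D2 K Γ) {α : ZFSet.{u}}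
    (hα : α.IsOrdinal) (hαK : α ∈ K) {H : ZFSet.{u} → ZFSet.{u}}
    (hH : ∀ ξ ∈ α, ∀ u ∈ K, (∀ w, w ∈ u ↔ ∃ ζ, ζ ∈ ξ ∧ w = H ζ) →
      H ξ ∈ K ∧ ∀ y ∈ K, Γ u y ↔ y = H ξ) :
    ∃ f, f ∈ K ∧ ∀ ζ y, ζ.pair y ∈ f ↔ ζ ∈ α ∧ y = H ζ :=
  let ⟨_, _, h⟩ := Mdl.exists_recursion_rel hΓ H
  (h α hα hαK hH).2

end TransModel

namespace TransModel

universe u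

variable {K : Set ZFSet.{u}} [Mdl K]

theorem Mdl.no_set_of_ordinals {b : ZFSet.{u}} (hb : b ∈ K)
    (h : ∀ ξ, ξ ∈ b ↔ ξ ∈ K ∧ ξ.IsOrdinal) : False := by
  have ho : b.IsOrdinal := by
    rw [ZFSet.isOrdinal_iff_forall_mem_isOrdinal]
    refine ⟨fun ξ hξ η hη => ?_, fun ξ hξ => ((h ξ).1 hξ).2⟩
    exact (h η).2 ⟨Mdl.trans K (Mdl.trans K hb hξ) hη, ((h ξ).1 hξ).2.mem hη⟩
  exact ZFSet.mem_irrefl b ((h b).2 ⟨hb, ho⟩)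

/-- Every set of the model is the bijective image of an ordinal. -/
theorem Mdl.exists_enumeration {x : ZFSet.{u}} (hx : x ∈ K) :
    ∃ δ F, δ ∈ K ∧ F ∈ K ∧ δ.IsOrdinal ∧ (∀ ξ y : ZFSet.{u}, ξ.pair y ∈ F → ξ ∈ δ ∧ y ∈ x) ∧
      (∀ ξ, ξ ∈ δ → ∃ y : ZFSet.{u}, ξ.pair y ∈ F) ∧ (∀ y, y ∈ x → ∃ ξ : ZFSet.{u}, ξ.pair y ∈ F) ∧
      (∀ ξ y z : ZFSet.{u}, ξ.pair y ∈ F → ξ.pair z ∈ F → y = z) ∧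
      ∀ ξ ζ y : ZFSet.{u}, ξ.pair y ∈ F → ζ.pair y ∈ F → ξ = ζ := by
  classical
  lift x to K using hx
  have hD : D2 K fun s y => y ∈ s ∨ ((∀ z, z ∈ s → ¬ z = z) ∧ y = (x : ZFSet)) := inferInstance
  obtain ⟨g, hg, hgF, hgd, hgR⟩ := Mdl.uniformization hD (Mdl.pow_mem x.2) (by
    intro s hs
    rcases s.eq_empty_or_nonempty with rfl | ⟨y, hy⟩
    · exact ⟨x, x.2, Or.inr ⟨by simp, rfl⟩⟩
    · exact ⟨y, Mdl.trans K (mem_pow.1 hs).2 hy, Or.inl hy⟩)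
  lift g to K using hg
  obtain ⟨H, hH⟩ := exists_recursive fun p : ZFSet.{u} → Prop =>
    if h : ∃ y, (ZFSet.sep (fun z => ¬ p z) x).pair y ∈ (g : ZFSet) then h.choose else ∅
  have hD : D2 K fun u y => ∃ s, s ∈ K ∧ ((∀ w, w ∈ K → (w ∈ s ↔ w ∈ (x : ZFSet) ∧ ¬ w ∈ u)) ∧
    s.pair y ∈ (g : ZFSet)) := inferInstance
  obtain ⟨R, hR, hrec⟩ := Mdl.exists_recursion_rel hD H
  have hs : ∀ u ∈ K, ZFSet.sep (fun z => ¬ z ∈ u) (x : ZFSet) ∈ K := by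
    intro u hu
    lift u to K using hu
    have hD : D1 K fun z => ¬ z ∈ (u : ZFSet) := inferInstance
    exact Mdl.sep_mem hD x.2
  have hHg : ∀ ξ, ∀ u ∈ K, (∀ w, w ∈ u ↔ ∃ ζ, ζ ∈ ξ ∧ w = H ζ) →
      (ZFSet.sep (fun z => ¬ z ∈ u) (x : ZFSet)).pair (H ξ) ∈ (g : ZFSet) := by
    intro ξ u hu huH
    have e : (fun w => ∃ ζ, ζ ∈ ξ ∧ w = H ζ) = fun w => w ∈ u :=
      funext fun w => propext (huH w).symm
    have := hH ξ
    rw [e] at this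
    rw [this]
    have h := hgd _ (mem_pow.2 ⟨fun z hz => (ZFSet.mem_sep.1 hz).1, hs u hu⟩)
    rw [dif_pos h]
    exact h.choose_spec
  have hΓ : ∀ ξ, ∀ u ∈ K, (∀ w, w ∈ u ↔ ∃ ζ, ζ ∈ ξ ∧ w = H ζ) → H ξ ∈ K ∧ ∀ y ∈ K,
      (∃ s, s ∈ K ∧ ((∀ w, w ∈ K → (w ∈ s ↔ w ∈ (x : ZFSet) ∧ ¬ w ∈ u)) ∧
        s.pair y ∈ (g : ZFSet))) ↔ y = H ξ := by
    intro ξ u hu huH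
    have h := hHg ξ u hu huH
    refine ⟨(Mdl.of_opair g.2 h).2, fun y hy => ⟨?_, ?_⟩⟩
    · rintro ⟨s, hsK, h1, h2⟩
      have : s = ZFSet.sep (fun z => ¬ z ∈ u) x :=
        Mdl.ext_mem K hsK (hs u hu) fun w hw => by rw [h1 w hw, ZFSet.mem_sep]
      exact hgF _ _ _ h2 (this ▸ h)
    · rintro rfl
      exact ⟨_, hs u hu, fun w _ => ZFSet.mem_sep, h⟩
  have hgraph := fun α hα hαK => hrec α hα hαK fun ξ _ => hΓ ξ
  have himg : ∀ α ∈ K, α.IsOrdinal → ∃ u, u ∈ K ∧ ∀ w, w ∈ u ↔ ∃ ζ, ζ ∈ α ∧ w = H ζ := by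
    intro α hαK hα
    obtain ⟨f, hf, hfH⟩ := (hgraph α hα hαK).2
    obtain ⟨u, hu, h⟩ := Mdl.exists_image hf hαK
    refine ⟨u, hu, fun w => (h w).trans (exists_congr fun z => and_congr_right fun hz => ?_)⟩
    rw [hfH, and_iff_right hz]
  have hnew : ∀ ξ ∈ K, ξ.IsOrdinal → (¬ ∀ z, z ∈ (x : ZFSet) → ∃ ζ, ζ ∈ ξ ∧ z = H ζ) →
      H ξ ∈ (x : ZFSet) ∧ ∀ ζ ∈ ξ, H ξ ≠ H ζ := by
    intro ξ hξK hξ hne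
    obtain ⟨u, hu, huH⟩ := himg ξ hξK hξ
    push Not at hne
    obtain ⟨z, hz, hz'⟩ := hne
    rcases (hgR _ _ (hHg ξ u hu huH)).2 with h | ⟨h, -⟩
    · rw [ZFSet.mem_sep] at h
      exact ⟨h.1, fun ζ hζ e => h.2 ((huH _).2 ⟨ζ, hζ, e⟩)⟩
    · refine (h z (ZFSet.mem_sep.2 ⟨hz, fun h => ?_⟩) rfl).elim
      obtain ⟨ζ, hζ, e⟩ := (huH _).1 h
      exact hz' ζ hζ e
  by_cases hex : ∃ ξ, ξ ∈ K ∧ ξ.IsOrdinal ∧ ∀ z, z ∈ (x : ZFSet) → ∃ ζ, ζ ∈ ξ ∧ z = H ζ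
  · obtain ⟨ξ, hξK, hξ, hP⟩ := hex
    obtain ⟨δ, hδ, hδP, hle, hmin⟩ := exists_least
      (P := fun ξ => ∀ z, z ∈ (x : ZFSet) → ∃ ζ, ζ ∈ ξ ∧ z = H ζ) hξ hP
    have hδK : δ ∈ K := by
      rcases hle with rfl | h
      exacts [hξK, Mdl.trans K hξK h]
    have hn := fun η (hη : η ∈ δ) => hnew η (Mdl.trans K hδK hη) (hδ.mem hη) (hmin η hη)
    obtain ⟨F, hF, hFH⟩ := (hgraph δ hδ hδK).2
    refine ⟨δ, F, hδK, hF, hδ, ?_, ?_, ?_, ?_, ?_⟩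
    · intro ξ y h
      obtain ⟨h1, rfl⟩ := (hFH _ _).1 h
      exact ⟨h1, (hn ξ h1).1⟩
    · exact fun ξ h => ⟨_, (hFH _ _).2 ⟨h, rfl⟩⟩
    · intro y hy
      obtain ⟨ζ, h1, h2⟩ := hδP y hy
      exact ⟨ζ, (hFH _ _).2 ⟨h1, h2⟩⟩
    · intro ξ y z h h'
      rw [((hFH _ _).1 h).2, ((hFH _ _).1 h').2]
    · intro ξ ζ y h h'
      obtain ⟨h1, rfl⟩ := (hFH _ _).1 h
      obtain ⟨h2, h3⟩ := (hFH _ _).1 h'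
      rcases (hδ.mem h1).mem_trichotomous (hδ.mem h2) with h | h | h
      · exact ((hn ζ h2).2 ξ h h3.symm).elim
      · exact h
      · exact ((hn ξ h1).2 ζ h h3).elim
  · push Not at hex
    have hn := fun ξ hξK (hξ : ξ.IsOrdinal) => hnew ξ hξK hξ fun h => by
      obtain ⟨z, hz, hz'⟩ := hex ξ hξK hξ
      obtain ⟨ζ, h1, h2⟩ := h z hz
      exact hz' ζ h1 h2
    have hRH : ∀ ξ ∈ K, ξ.IsOrdinal → ∀ y ∈ K, R ξ y ↔ y = H ξ := fun ξ hξK hξ =>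
      (hgraph (insert ξ ξ) (ZFSet.isOrdinal_succ hξ) (Mdl.insert_mem hξK hξK)).1 ξ (by simp)
    have hR' := @D2.app K R hR
    have hD : D2 K fun z ξ => ξ.IsOrdinal ∧ R ξ z := inferInstance
    obtain ⟨b, hb, hbm⟩ := Mdl.replacement hD x.2 (by
      rintro z hz ξ hξ ζ hζ ⟨h1, h2⟩ ⟨h3, h4⟩
      have hzK := Mdl.trans K x.2 hz
      rw [hRH _ hξ h1 _ hzK] at h2
      rw [hRH _ hζ h3 _ hzK] at h4
      rcases h1.mem_trichotomous h3 with h | h | h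
      · exact ((hn ζ hζ h3).2 ξ h (h4.symm.trans h2)).elim
      · exact h
      · exact ((hn ξ hξ h1).2 ζ h (h2.symm.trans h4)).elim)
    refine (Mdl.no_set_of_ordinals hb fun ξ => ?_).elim
    rw [hbm]
    refine ⟨fun ⟨h1, z, hz, h2, _⟩ => ⟨h1, h2⟩, fun ⟨h1, h2⟩ => ⟨h1, H ξ, (hn ξ h1 h2).1, h2, ?_⟩⟩
    exact (hRH ξ h1 h2 _ (Mdl.trans K x.2 (hn ξ h1 h2).1)).2 rfl

end TransModel

namespace TransModel

universe u

variable {K : Set ZFSet.{u}}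

section func

variable {a b f x y z : ZFSet.{u}}

theorem isFunc_dom (h : ZFSet.IsFunc a b f) (hxy : x.pair y ∈ f) : x ∈ a :=
  (ZFSet.pair_mem_prod.1 (h.1 hxy)).1

theorem isFunc_cod (h : ZFSet.IsFunc a b f) (hxy : x.pair y ∈ f) : y ∈ b :=
  (ZFSet.pair_mem_prod.1 (h.1 hxy)).2

theorem isFunc_unique (h : ZFSet.IsFunc a b f) (hxy : x.pair y ∈ f) (hxz : x.pair z ∈ f) : y = z :=
  (h.2 x (isFunc_dom h hxy)).unique hxy hxz

theorem isFunc_value (h : ZFSet.IsFunc a b f) (hx : x ∈ a) : ∃ y, y ∈ b ∧ x.pair y ∈ f :=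
  let ⟨y, hy, _⟩ := h.2 x hx
  ⟨y, isFunc_cod h hy, hy⟩

end func

variable [Mdl K]

theorem Mdl.exists_func {R : ZFSet.{u} → ZFSet.{u} → Prop} (hR : D2 K R) {a b : ZFSet.{u}}
    (ha : a ∈ K) (hb : b ∈ K) (h : ∀ x ∈ a, ∃ y, y ∈ b ∧ R x y) :
    ∃ f, f ∈ K ∧ ZFSet.IsFunc a b f ∧ ∀ x y, x.pair y ∈ f → R x y := by
  have hR' := @D2.app K R hR
  lift b to K using hb
  have hD : D2 K fun x y => y ∈ (b : ZFSet) ∧ R x y := inferInstance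
  obtain ⟨f, hf, h1, h2, h3⟩ := Mdl.uniformization hD ha fun x hx => by
    obtain ⟨y, hy, hxy⟩ := h x hx
    exact ⟨y, Mdl.trans K b.2 hy, hy, hxy⟩
  have hp : a.prod b ∈ K := Mdl.prod_mem ha b.2
  lift f to K using hf
  have hD : D1 K fun p => p ∈ (f : ZFSet) := inferInstance
  refine ⟨_, Mdl.sep_mem hD hp, ⟨fun p hp => (ZFSet.mem_sep.1 hp).1, fun x hx => ?_⟩,
    fun x y hxy => (h3 x y (ZFSet.mem_sep.1 hxy).2).2.2⟩
  obtain ⟨y, hy⟩ := h2 x hx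
  exact ⟨y, ZFSet.mem_sep.2 ⟨ZFSet.pair_mem_prod.2 ⟨hx, (h3 x y hy).2.1⟩, hy⟩,
    fun z hz => h1 _ _ _ (ZFSet.mem_sep.1 hz).2 hy⟩

theorem Mdl.exists_bound {ρ α δ g : ZFSet.{u}} (hα : α.IsOrdinal) (hαK : α ∈ K) (hρ : ρ ∈ K)
    (hgK : g ∈ K) (hg : ZFSet.IsFunc δ α g) (hρδ : ρ ⊆ δ)
    (h : ∀ g' ∈ K, ZFSet.IsFunc ρ α g' → ¬ CofinalIn ρ α g') :
    ∃ γ, γ ∈ α ∧ ∀ ζ ∈ ρ, ∀ v, ζ.pair v ∈ g → v ∈ γ := by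
  lift g to K using hgK
  have hD : D2 K fun x y => x.pair y ∈ (g : ZFSet) := inferInstance
  obtain ⟨g', hg', h1, h2⟩ := Mdl.exists_func hD hρ hαK fun x hx => isFunc_value hg (hρδ hx)
  have h := h g' hg' h1
  simp only [CofinalIn] at h
  push Not at h
  obtain ⟨γ, hγ, h⟩ := h
  refine ⟨γ, hγ, fun ζ hζ v hv => ?_⟩
  obtain ⟨w, hw, hw'⟩ := isFunc_value h1 hζ
  obtain rfl := isFunc_unique hg hv (h2 _ _ hw')
  have := h ζ hζ v hw'
  rcases (hα.mem hγ).mem_trichotomous (hα.mem hw) with h | h | h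
  exacts [(this.1 h).elim, (this.2 h).elim, h]

/-- Functions from smaller ordinals into a regular ordinal are bounded. -/
theorem Mdl.regular_bound {R : ZFSet.{u} → ZFSet.{u} → Prop} (hR : D2 K R) {θ b : ZFSet.{u}}
    (hθ : θ.IsOrdinal) (hθK : θ ∈ K) (hr : RegularIn K θ) (hb : b ∈ θ)
    (h : ∀ x ∈ b, ∃ y, y ∈ θ ∧ R x y) : ∃ γ, γ ∈ θ ∧ ∀ x ∈ b, ∃ y, y ∈ γ ∧ R x y := by
  have hbK := Mdl.trans K hθK hb
  obtain ⟨f, hf, h1, h2⟩ := Mdl.exists_func hR hbK hθK h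
  obtain ⟨γ, hγ, h3⟩ := Mdl.exists_bound hθ hθK hbK hf h1 (fun _ h => h) fun g => hr b hb g
  refine ⟨γ, hγ, fun x hx => ?_⟩
  obtain ⟨y, -, hy⟩ := isFunc_value h1 hx
  exact ⟨y, h3 x hx y hy, h2 x y hy⟩

theorem Mdl.exists_cofinality {α : ZFSet.{u}} (hα : α.IsOrdinal) (hαK : α ∈ K) :
    ∃ δ g, δ ∈ K ∧ g ∈ K ∧ δ.IsOrdinal ∧ (δ = α ∨ δ ∈ α) ∧ ZFSet.IsFunc δ α g ∧ CofinalIn δ α g ∧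
      RegularIn K δ ∧ ∀ η ∈ δ, ∀ g' ∈ K, ZFSet.IsFunc η α g' → ¬ CofinalIn η α g' := by
  obtain ⟨δ, hδ, ⟨g, hgK, hg, hc⟩, hle, hmin⟩ := exists_least
    (P := fun δ => ∃ g, g ∈ K ∧ ZFSet.IsFunc δ α g ∧ CofinalIn δ α g) hα (by
      have hD : D2 K fun x y => x = y := inferInstance
      obtain ⟨f, hf, h1, h2⟩ := Mdl.exists_func hD hαK hαK fun x hx => ⟨x, hx, rfl⟩
      refine ⟨f, hf, h1, fun γ hγ => ?_⟩
      obtain ⟨y, hy, hy'⟩ := isFunc_value h1 hγ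
      exact ⟨γ, hγ, y, hy', Or.inr (h2 _ _ hy')⟩)
  have hmin' : ∀ η ∈ δ, ∀ g' ∈ K, ZFSet.IsFunc η α g' → ¬ CofinalIn η α g' :=
    fun η hη g' h1 h2 h3 => hmin η hη ⟨g', h1, h2, h3⟩
  have hδK : δ ∈ K := by
    rcases hle with rfl | h
    exacts [hαK, Mdl.trans K hαK h]
  refine ⟨δ, g, hδK, hgK, hδ, hle, hg, hc, fun β hβ f hfK hf hfc => ?_, hmin'⟩
  have hβK := Mdl.trans K hδK hβ
  have hαK' := hαK
  have hδK' := hδK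
  lift f to K using hfK
  lift g to K using hgK
  lift α to K using hαK
  lift δ to K using hδK
  have hD : D2 K fun ξ γ => ∀ ρ, ρ ∈ (δ : ZFSet) → ξ.pair ρ ∈ (f : ZFSet) →
    ∀ ζ, ζ ∈ insert ρ ρ → ∀ v, v ∈ (α : ZFSet) → ζ.pair v ∈ (g : ZFSet) → v ∈ γ ∨ v = γ :=
    inferInstance
  obtain ⟨k, hk, hkf, hkR⟩ := Mdl.exists_func hD hβK hαK' fun ξ hξ => by
    obtain ⟨ρ, hρ, hρf⟩ := isFunc_value hf hξ
    obtain ⟨v, hv, hvg⟩ := isFunc_value hg hρ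
    obtain ⟨γ, hγ, hγb⟩ := Mdl.exists_bound hα hαK' (Mdl.trans K hδK' hρ) g.2 hg
      (hδ.subset_of_mem hρ) (hmin' ρ hρ)
    obtain ⟨m, hm, hvm, hγm⟩ : ∃ m, m ∈ (α : ZFSet) ∧ (v ∈ m ∨ v = m) ∧ (γ ∈ m ∨ γ = m) := by
      rcases (hα.mem hv).mem_trichotomous (hα.mem hγ) with h | h | h
      exacts [⟨γ, hγ, Or.inl h, Or.inr rfl⟩, ⟨γ, hγ, Or.inr h, Or.inr rfl⟩,
        ⟨v, hv, Or.inr rfl, Or.inl h⟩]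
    refine ⟨m, hm, fun ρ' _ h1 ζ hζ v' hv' h2 => ?_⟩
    obtain rfl := isFunc_unique hf hρf h1
    rcases ZFSet.mem_insert_iff.1 hζ with rfl | hζ
    · exact isFunc_unique hg hvg h2 ▸ hvm
    · have := hγb ζ hζ v' h2
      rcases hγm with h | rfl
      exacts [Or.inl ((hα.mem hm).mem_trans this h), Or.inl this]
  refine hmin' β hβ k hk hkf fun γ hγ => ?_
  obtain ⟨ζ, hζ, v, hζv, hγv⟩ := hc γ hγ
  obtain ⟨ξ, hξ, ρ, hξρ, hζρ⟩ := hfc ζ hζ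
  obtain ⟨m, hm, hξm⟩ := isFunc_value hkf hξ
  have := hkR _ _ hξm ρ (isFunc_cod hf hξρ) hξρ ζ (by
    rcases hζρ with h | h <;> simp [h]) v (isFunc_cod hg hζv) hζv
  refine ⟨ξ, hξ, m, hξm, ?_⟩
  rcases this with h | rfl
  · rcases hγv with h' | rfl
    exacts [Or.inl ((hα.mem hm).mem_trans h' h), Or.inl h]
  · exact hγv

/-- A set containing `∅` and closed under pairing with elements of `a`. -/
theorem Mdl.exists_closed_pair {a : ZFSet.{u}} (ha : a ∈ K) :
    ∃ Y, Y ∈ K ∧ ∅ ∈ Y ∧ ∀ x ∈ a, ∀ y ∈ Y, x.pair y ∈ Y := by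
  classical
  have ha' := ha
  lift a to K using ha
  obtain ⟨H, hH⟩ := exists_recursive fun p : ZFSet.{u} → Prop =>
    if h : ∃ u : ZFSet.{u}, ∀ w, w ∈ u ↔ p w then
      insert ∅ (ZFSet.prod a (ZFSet.sUnion h.choose)) else ∅
  have hD : D2 K fun u y => ∀ p, p ∈ K → (p ∈ y ↔ p = ∅ ∨ ∃ x, x ∈ (a : ZFSet) ∧
    ∃ v, v ∈ ZFSet.sUnion u ∧ p = x.pair v) := inferInstance
  have hHu : ∀ ξ u, (∀ w, w ∈ u ↔ ∃ ζ, ζ ∈ ξ ∧ w = H ζ) →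
      H ξ = insert ∅ (ZFSet.prod a (ZFSet.sUnion u)) := by
    intro ξ u hu
    have h : ∃ u : ZFSet.{u}, ∀ w, w ∈ u ↔ ∃ ζ, ζ ∈ ξ ∧ w = H ζ := ⟨u, hu⟩
    rw [hH, dif_pos h]
    have := h.choose_spec
    congr 3
    ext w
    rw [this, hu]
  have hω := Mdl.omega_mem K
  obtain ⟨f, hf, hfH⟩ := Mdl.recursion hD isOrdinal_omega hω (H := H) (by
    intro ξ _ u hu huH
    have e := hHu ξ u huH
    have hHK : H ξ ∈ K := by
      rw [e]
      exact Mdl.insert_mem (Mdl.empty_mem K) (Mdl.prod_mem ha' (Mdl.sUnion_mem hu))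
    have key : ∀ p, p ∈ H ξ ↔ p = ∅ ∨ ∃ x, x ∈ (a : ZFSet) ∧ ∃ v, v ∈ ZFSet.sUnion u ∧
        p = x.pair v := fun p => by
      rw [e, ZFSet.mem_insert_iff, ZFSet.mem_prod]
    refine ⟨hHK, fun y hy => ⟨fun h => ?_, ?_⟩⟩
    · exact Mdl.ext_mem K hy hHK fun p hp => by rw [h p hp, key]
    · rintro rfl
      exact fun p _ => key p)
  obtain ⟨u, hu, huH⟩ := Mdl.exists_image hf hω
  have huH' : ∀ w, w ∈ u ↔ ∃ n, w = H (nat n) := by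
    intro w
    rw [huH]
    constructor
    · rintro ⟨x, hx, h⟩
      obtain ⟨n, rfl⟩ := mem_omega_iff.1 hx
      exact ⟨n, ((hfH _ _).1 h).2⟩
    · rintro ⟨n, rfl⟩
      exact ⟨nat n, nat_mem_omega n, (hfH _ _).2 ⟨nat_mem_omega n, rfl⟩⟩
  have hHn : ∀ ξ ∈ ZFSet.omega, ∃ v : ZFSet.{u}, H ξ = insert ∅ (ZFSet.prod a (ZFSet.sUnion v)) ∧
      ∀ w, w ∈ v ↔ ∃ ζ, ζ ∈ ξ ∧ w = H ζ := by
    intro ξ hξ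
    obtain ⟨v, -, hv⟩ := Mdl.exists_image hf (Mdl.trans K hω hξ)
    have hv' : ∀ w, w ∈ v ↔ ∃ ζ, ζ ∈ ξ ∧ w = H ζ := fun w => (hv w).trans
      (exists_congr fun ζ => and_congr_right fun h => by
        rw [hfH, and_iff_right (isOrdinal_omega.mem_trans h hξ)])
    exact ⟨v, hHu ξ v hv', hv'⟩
  refine ⟨ZFSet.sUnion u, Mdl.sUnion_mem hu, ?_, fun x hx y hy => ?_⟩
  · obtain ⟨v, hv, -⟩ := hHn _ (nat_mem_omega 0)
    exact ZFSet.mem_sUnion.2 ⟨_, (huH' _).2 ⟨0, rfl⟩, by rw [hv]; simp⟩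
  · obtain ⟨w, hw, hyw⟩ := ZFSet.mem_sUnion.1 hy
    obtain ⟨n, rfl⟩ := (huH' _).1 hw
    obtain ⟨v, hv, hv'⟩ := hHn _ (nat_mem_omega (n + 1))
    refine ZFSet.mem_sUnion.2 ⟨_, (huH' _).2 ⟨n + 1, rfl⟩, ?_⟩
    rw [hv, ZFSet.mem_insert_iff, ZFSet.pair_mem_prod]
    exact Or.inr ⟨hx, ZFSet.mem_sUnion.2 ⟨_, (hv' _).2 ⟨nat n, by simp [nat_succ], rfl⟩, hyw⟩⟩

end TransModel

namespace TransModel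

universe u

variable {K : Set ZFSet.{u}} [Mdl K]

theorem pair_ne_empty (x y : ZFSet.{u}) : x.pair y ≠ ∅ := by
  intro h
  have : ({x} : ZFSet.{u}) ∈ x.pair y := by simp [ZFSet.pair]
  rw [h] at this
  exact ZFSet.notMem_empty _ this

/-- `f` maps a part of `Y` onto `a`. -/
def Onto (Y a f : ZFSet.{u}) : Prop :=
  (∀ x, x ∈ Y → ∀ y, y ∈ a → ∀ z, z ∈ a → x.pair y ∈ f → x.pair z ∈ f → y = z) ∧
    ∀ y, y ∈ a → ∃ x, x ∈ Y ∧ x.pair y ∈ f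

instance Df.onto {n : ℕ} {t t' t'' : (Fin n → ZFSet.{u}) → ZFSet.{u}}
    [ht : Tm (fun x : K => x) t t] [ht' : Tm (fun x : K => x) t' t']
    [ht'' : Tm (fun x : K => x) t'' t''] : Df K fun v => Onto (t v) (t' v) (t'' v) :=
  Tr.subst3 (P := Onto) (Q := Onto)
    (inferInstanceAs (Df K fun w : Fin 3 → ZFSet.{u} =>
      (∀ x, x ∈ w 0 → ∀ y, y ∈ w 1 → ∀ z, z ∈ w 1 → x.pair y ∈ w 2 → x.pair z ∈ w 2 → y = z) ∧
      ∀ y, y ∈ w 1 → ∃ x, x ∈ w 0 ∧ x.pair y ∈ w 2))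
    ht ht' ht''

theorem Mdl.exists_not_onto {Y : ZFSet.{u}} (hY : Y ∈ K) :
    ∃ α, α ∈ K ∧ α.IsOrdinal ∧ ∀ f ∈ K, ¬ Onto Y α f := by
  obtain ⟨δ, F, hδK, hF, hδ, h1, h2, h3, h4, h5⟩ := Mdl.exists_enumeration (Mdl.pow_mem hY)
  refine ⟨δ, hδK, hδ, fun f hf ⟨hf1, hf2⟩ => ?_⟩
  have hδK' := hδK
  have hY' := hY
  lift f to K using hf
  lift δ to K using hδK
  lift F to K using hF
  lift Y to K using hY
  have hD : D1 K fun x => ∃ γ, γ ∈ (δ : ZFSet) ∧ (x.pair γ ∈ (f : ZFSet) ∧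
    ∃ s, s ∈ pow K Y ∧ (γ.pair s ∈ (F : ZFSet) ∧ ¬ x ∈ s)) := inferInstance
  obtain ⟨γ, hγ⟩ := h3 _ (mem_pow.2 ⟨fun z hz => (ZFSet.mem_sep.1 hz).1, Mdl.sep_mem hD hY'⟩)
  obtain ⟨hγδ, hS⟩ := h1 _ _ hγ
  obtain ⟨x, hx, hxγ⟩ := hf2 γ hγδ
  by_cases hxs : x ∈ ZFSet.sep (fun x => ∃ γ, γ ∈ (δ : ZFSet) ∧ (x.pair γ ∈ (f : ZFSet) ∧
    ∃ s, s ∈ pow K Y ∧ (γ.pair s ∈ (F : ZFSet) ∧ ¬ x ∈ s))) Y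
  · obtain ⟨γ', hγ', hxγ', s, hs, hγs, hn⟩ := (ZFSet.mem_sep.1 hxs).2
    obtain rfl := hf1 x hx γ hγδ γ' hγ' hxγ hxγ'
    exact hn (h4 _ _ _ hγs hγ ▸ hxs)
  · exact hxs (ZFSet.mem_sep.2 ⟨hx, γ, hγδ, hxγ, _, hS, hγ, hxs⟩)

/-- There is a regular ordinal above any ordinal. -/
theorem Mdl.exists_regular {l : ZFSet.{u}} (hl : l.IsOrdinal) (hlK : l ∈ K) :
    ∃ θ, θ ∈ K ∧ θ.IsOrdinal ∧ RegularIn K θ ∧ l ∈ θ := by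
  obtain ⟨Y, hY, h0, hYp⟩ := Mdl.exists_closed_pair (Mdl.insert_mem hlK hlK)
  obtain ⟨α, ⟨hα, hαP, -, hmin⟩, hαK⟩ : ∃ α, (α.IsOrdinal ∧ (∀ f ∈ K, ¬ Onto Y (insert α α) f) ∧
      True ∧ ∀ γ, γ ∈ α → ¬ ∀ f ∈ K, ¬ Onto Y (insert γ γ) f) ∧ α ∈ K := by
    obtain ⟨β, hβK, hβ, hP⟩ := Mdl.exists_not_onto hY
    obtain ⟨α, h1, h2, h3, h4⟩ := exists_least (P := fun α => ∀ f ∈ K, ¬ Onto Y (insert α α) f) hβ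
      fun f hf hO => hP f hf ⟨fun x hx y hy z hz => hO.1 x hx y (by simp [hy]) z (by simp [hz]),
        fun y hy => hO.2 y (by simp [hy])⟩
    refine ⟨α, ⟨h1, h2, trivial, h4⟩, ?_⟩
    rcases h3 with rfl | h
    exacts [hβK, Mdl.trans K hβK h]
  push Not at hmin
  obtain ⟨δ, g, hδK, hgK, hδ, -, hg, hc, hr, -⟩ := Mdl.exists_cofinality hα hαK
  refine ⟨δ, hδK, hδ, hr, ?_⟩
  by_contra hlδ
  have hδl : ∀ ξ, ξ ∈ δ → ξ ∈ insert l l := by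
    intro ξ hξ
    rw [ZFSet.mem_insert_iff]
    rcases hl.mem_trichotomous hδ with h | h | h
    exacts [(hlδ h).elim, Or.inr (h ▸ hξ), Or.inr (hl.mem_trans hξ h)]
  have hαK' := hαK
  have hδK' := hδK
  have hY' := hY
  lift g to K using hgK
  lift α to K using hαK
  lift δ to K using hδK
  lift Y to K using hY
  have hD : D2 K fun ξ e => ∀ η, η ∈ (α : ZFSet) → ξ.pair η ∈ (g : ZFSet) →
    Onto Y (insert η η) e := inferInstance
  obtain ⟨E, hE, hE1, hE2, hE3⟩ := Mdl.uniformization hD hδK' fun ξ hξ => by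
    obtain ⟨η, hη, hξη⟩ := isFunc_value hg hξ
    obtain ⟨e, he, hO⟩ := hmin η hη
    refine ⟨e, he, fun η' _ h => ?_⟩
    rwa [← isFunc_unique hg hξη h]
  lift E to K using hE
  let R (p γ : ZFSet.{u}) : Prop := (p = ∅ ∧ γ = α) ∨ ∃ ξ, ξ ∈ (δ : ZFSet) ∧ ∃ x, x ∈ (Y : ZFSet) ∧
    (p = ξ.pair x ∧ ∃ e, e ∈ K ∧ (ξ.pair e ∈ (E : ZFSet) ∧ (x.pair γ ∈ e ∧
      ∀ η, η ∈ (α : ZFSet) → ξ.pair η ∈ (g : ZFSet) → γ ∈ insert η η)))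
  have hR : D2 K R := by
    unfold R
    infer_instance
  have hR' := @D2.app K R hR
  obtain ⟨S, hS⟩ : ∃ S : K, (S : ZFSet) = insert (α : ZFSet) (α : ZFSet) :=
    ⟨⟨_, Mdl.insert_mem hαK' hαK'⟩, rfl⟩
  have hD : D1 K fun q => ∃ p, p ∈ (Y : ZFSet) ∧ ∃ γ, γ ∈ (S : ZFSet) ∧
    (q = p.pair γ ∧ R p γ) := inferInstance
  have hf := Mdl.sep_mem hD (Mdl.prod_mem hY' S.2)
  have hfm : ∀ p γ, p ∈ (Y : ZFSet) → γ ∈ (S : ZFSet) → (p.pair γ ∈ ZFSet.sep (fun q =>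
      ∃ p, p ∈ (Y : ZFSet) ∧ ∃ γ, γ ∈ (S : ZFSet) ∧ (q = p.pair γ ∧ R p γ))
      (ZFSet.prod Y S) ↔ R p γ) := by
    intro p γ hp hγ
    rw [ZFSet.mem_sep, ZFSet.pair_mem_prod]
    constructor
    · rintro ⟨-, p', -, γ', -, he, h⟩
      obtain ⟨rfl, rfl⟩ := ZFSet.pair_inj.1 he
      exact h
    · exact fun h => ⟨⟨hp, hγ⟩, p, hp, γ, hγ, rfl, h⟩
  refine hαP _ hf (hS ▸ ⟨fun p hp γ hγ γ' hγ' h h' => ?_, fun γ hγ => ?_⟩)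
  · rw [hfm p _ hp hγ] at h
    rw [hfm p _ hp hγ'] at h'
    rcases h with ⟨rfl, rfl⟩ | ⟨ξ, hξ, x, hx, rfl, e, he, h1, h2, h3⟩
    · rcases h' with ⟨-, rfl⟩ | ⟨ξ', -, x', -, h, -⟩
      · rfl
      · exact (pair_ne_empty _ _ h.symm).elim
    · rcases h' with ⟨h, -⟩ | ⟨ξ', -, x', -, h, e', he', h1', h2', h3'⟩
      · exact (pair_ne_empty _ _ h).elim
      · obtain ⟨rfl, rfl⟩ := ZFSet.pair_inj.1 h
        obtain rfl := hE1 _ _ _ h1 h1'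
        obtain ⟨η, hη, hξη⟩ := isFunc_value hg hξ
        exact ((hE3 _ _ h1).2 η hη hξη).1 x hx γ (h3 η hη hξη) γ' (h3' η hη hξη) h2 h2'
  · rcases ZFSet.mem_insert_iff.1 (hS ▸ hγ) with rfl | hγα
    · exact ⟨∅, h0, (hfm _ _ h0 (hS ▸ hγ)).2 (Or.inl ⟨rfl, rfl⟩)⟩
    · obtain ⟨ξ, hξ, η, hξη, hγη⟩ := hc γ hγα
      obtain ⟨e, hξe⟩ := hE2 ξ hξ
      have hγη' : γ ∈ insert η η := by rcases hγη with h | h <;> simp [h]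
      obtain ⟨x, hx, hxγ⟩ := ((hE3 _ _ hξe).2 η (isFunc_cod hg hξη) hξη).2 γ hγη'
      have hpY := hYp ξ (hδl ξ hξ) x hx
      refine ⟨_, hpY, (hfm _ _ hpY hγ).2 (Or.inr ⟨ξ, hξ, x, hx, rfl, e,
        (Mdl.of_opair E.2 hξe).2, hξe, hxγ, fun η' _ h => ?_⟩)⟩
      rwa [← isFunc_unique hg hξη h]

end TransModel

namespace TransModel

universe u

variable {K : Set ZFSet.{u}}

theorem nat_mem_nat_iff {k n : ℕ} : nat.{u} k ∈ nat n ↔ k < n := by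
  have h : ∀ {k n : ℕ}, k < n → nat.{u} k ∈ nat n := by
    intro k n h
    induction h with
    | refl => simp [nat_succ]
    | step _ ih => simp [nat_succ, ih]
  refine ⟨fun hm => ?_, h⟩
  rcases lt_trichotomy k n with hl | rfl | hl
  exacts [hl, (ZFSet.mem_irrefl _ hm).elim, (ZFSet.mem_asymm hm (h hl)).elim]

theorem nat_injective : Function.Injective nat.{u} := by
  intro k n h
  rcases lt_trichotomy k n with hl | hl | hl
  · exact (ZFSet.mem_irrefl _ (h ▸ nat_mem_nat_iff.2 hl)).elim
  · exact hl
  · exact (ZFSet.mem_irrefl _ (h ▸ nat_mem_nat_iff.2 hl)).elim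

theorem mem_nat_iff {x : ZFSet.{u}} {n : ℕ} : x ∈ nat n ↔ ∃ k, k < n ∧ x = nat k := by
  constructor
  · intro h
    obtain ⟨k, rfl⟩ := mem_omega_iff.1 (isOrdinal_omega.mem_trans h (nat_mem_omega n))
    exact ⟨k, nat_mem_nat_iff.1 h, rfl⟩
  · rintro ⟨k, h, rfl⟩
    exact nat_mem_nat_iff.2 h

variable [Mdl K]

theorem Mdl.exists_sequence {Γ : ZFSet.{u} → ZFSet.{u} → Prop} (hΓ : D2 K Γ) {a : ℕ → ZFSet.{u}}
    (h : ∀ n, ∀ u ∈ K, (∀ w, w ∈ u ↔ ∃ k, k < n ∧ w = a k) → a n ∈ K ∧ ∀ y ∈ K, Γ u y ↔ y = a n) :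
    ∃ f, f ∈ K ∧ ∀ x y, x.pair y ∈ f ↔ ∃ n, x = nat n ∧ y = a n := by
  have hH : ∀ n, Function.extend nat a (fun _ => ∅) (nat n) = a n := fun n =>
    nat_injective.extend_apply a _ n
  obtain ⟨f, hf, hfH⟩ := Mdl.recursion hΓ isOrdinal_omega (Mdl.omega_mem K)
    (H := Function.extend nat a fun _ => ∅) (by
      intro ξ hξ u hu huH
      obtain ⟨n, rfl⟩ := mem_omega_iff.1 hξ
      rw [hH]
      refine h n u hu fun w => (huH w).trans ⟨?_, ?_⟩
      · rintro ⟨ζ, hζ, rfl⟩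
        obtain ⟨k, hk, rfl⟩ := mem_nat_iff.1 hζ
        exact ⟨k, hk, hH k⟩
      · rintro ⟨k, hk, rfl⟩
        exact ⟨nat k, nat_mem_nat_iff.2 hk, (hH k).symm⟩)
  refine ⟨f, hf, fun x y => (hfH x y).trans ⟨?_, ?_⟩⟩
  · rintro ⟨hx, rfl⟩
    obtain ⟨n, rfl⟩ := mem_omega_iff.1 hx
    exact ⟨n, rfl, hH n⟩
  · rintro ⟨n, rfl, rfl⟩
    exact ⟨nat_mem_omega n, (hH n).symm⟩

/-- `β` has countable cofinality in the model `K`. -/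
def Cw (K : Set ZFSet.{u}) (β : ZFSet.{u}) : Prop :=
  ∃ δ, δ ∈ insert ZFSet.omega.{u} ZFSet.omega.{u} ∧
    ∃ g, g ∈ K ∧ (ZFSet.IsFunc δ β g ∧ CofinalIn δ β g)

instance Tr.cw {M N : Set ZFSet.{u}} [Mdl M] [Mdl N] {j : M → N} {n : ℕ}
    {t s : (Fin n → ZFSet.{u}) → ZFSet.{u}} [ht : Tm j t s] :
    Tr j (fun v => Cw M (t v)) fun v => Cw N (s v) :=
  Tr.subst1 (P := Cw M) (Q := Cw N)
    (inferInstanceAs (Tr j (fun w : Fin 1 → ZFSet.{u} =>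
      ∃ δ, δ ∈ insert ZFSet.omega.{u} ZFSet.omega.{u} ∧ ∃ g, g ∈ M ∧
        (ZFSet.IsFunc δ (w 0) g ∧ CofinalIn δ (w 0) g)) fun w =>
      ∃ δ, δ ∈ insert ZFSet.omega.{u} ZFSet.omega.{u} ∧ ∃ g, g ∈ N ∧
        (ZFSet.IsFunc δ (w 0) g ∧ CofinalIn δ (w 0) g))) ht

theorem isOrdinal_sUnion {u : ZFSet.{u}} (h : ∀ x ∈ u, x.IsOrdinal) :
    (ZFSet.sUnion u).IsOrdinal := by
  rw [ZFSet.isOrdinal_iff_forall_mem_isOrdinal]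
  constructor
  · intro x hx y hy
    obtain ⟨z, hz, hxz⟩ := ZFSet.mem_sUnion.1 hx
    exact ZFSet.mem_sUnion.2 ⟨z, hz, (h z hz).mem_trans hy hxz⟩
  · intro x hx
    obtain ⟨z, hz, hxz⟩ := ZFSet.mem_sUnion.1 hx
    exact (h z hz).mem hxz

theorem Mdl.regular_limit {θ α : ZFSet.{u}} (hθ : θ.IsOrdinal) (hθK : θ ∈ K)
    (hr : RegularIn K θ) (hω : ZFSet.omega ∈ θ) (hα : α ∈ θ) : ∃ γ, γ ∈ θ ∧ α ∈ γ := by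
  have hα' := hα
  lift α to K using Mdl.trans K hθK hα
  have hD : D2 K fun x y => y = (α : ZFSet) := inferInstance
  obtain ⟨γ, hγ, h⟩ := Mdl.regular_bound hD hθ hθK hr (hθ.mem_trans (nat_mem_omega 1) hω)
    fun x _ => ⟨α, hα', rfl⟩
  obtain ⟨y, hy, rfl⟩ := h ∅ (by simp [nat_succ, nat_zero])
  exact ⟨γ, hγ, hy⟩

/-- Closing off below a regular ordinal in countably many steps. -/
theorem Mdl.exists_closure_point {Φ : ZFSet.{u} → ZFSet.{u} → Prop} (hΦ : D2 K Φ)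
    {θ η : ZFSet.{u}} (hθ : θ.IsOrdinal) (hθK : θ ∈ K) (hr : RegularIn K θ)
    (hω : ZFSet.omega ∈ θ) (hη : η ∈ θ) (hex : ∀ α ∈ θ, ∃ x, x ∈ θ ∧ α ∈ x ∧ Φ α x)
    (hmono : ∀ α x y, x ∈ y → y ∈ θ → Φ α x → Φ α y) :
    ∃ β, β ∈ θ ∧ η ∈ β ∧ Cw K β ∧ ∀ x ∈ β, ∃ α ∈ β, x ∈ α ∧ ∃ y ∈ β, Φ α y := by
  let Ψ (α x : ZFSet.{u}) : Prop := α ∈ x ∧ Φ α x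
  have hΦ' := @D2.app K Φ hΦ
  have hΨ : D2 K Ψ := by
    unfold Ψ
    infer_instance
  have hΨm : ∀ α x y, x ∈ y → y ∈ θ → Ψ α x → Ψ α y := fun α x y hx hy h =>
    ⟨(hθ.mem hy).mem_trans h.1 hx, hmono α x y hx hy h.2⟩
  have hleast : ∀ α ∈ θ, ∃ x, x ∈ θ ∧ Ψ α x ∧ ∀ y, y ∈ x → ¬ Ψ α y := by
    intro α hα
    obtain ⟨x, hx, h⟩ := hex α hα
    obtain ⟨y, -, h2, h3, h4⟩ := exists_least (P := Ψ α) (hθ.mem hx) h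
    refine ⟨y, ?_, h2, h4⟩
    rcases h3 with rfl | h3
    exacts [hx, hθ.mem_trans h3 hx]
  choose! f hf using hleast
  have haθ : ∀ n, f^[n] η ∈ θ := by
    intro n
    induction n with
    | zero => exact hη
    | succ n ih => rw [Function.iterate_succ_apply']; exact (hf _ ih).1
  have haΨ : ∀ {k n}, k < n → Ψ (f^[k] η) (f^[n] η) := by
    intro k n h
    induction h with
    | refl => rw [Nat.succ_eq_add_one, Function.iterate_succ_apply']; exact (hf _ (haθ k)).2.1
    | @step m _ ih =>
      have hs : f^[m] η ∈ f^[m + 1] η := by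
        rw [Function.iterate_succ_apply']
        exact (hf _ (haθ m)).2.1.1
      exact hΨm _ _ _ hs (haθ _) ih
  have hη' := hη
  lift η to K using Mdl.trans K hθK hη
  have hθK' := hθK
  lift θ to K using hθK
  have hΨ' := @D2.app K Ψ hΨ
  have hD : D2 K fun u y => (u = ∅ ∧ y = (η : ZFSet)) ∨ (¬ u = ∅ ∧ (y ∈ (θ : ZFSet) ∧
    ((∀ w, w ∈ u → Ψ w y) ∧ ∀ y', y' ∈ y → ¬ ∀ w, w ∈ u → Ψ w y'))) := inferInstance
  obtain ⟨s, hs, hsa⟩ := Mdl.exists_sequence hD (a := fun n => f^[n] η) (by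
    intro n u hu hua
    refine ⟨Mdl.trans K hθK' (haθ n), fun y hy => ?_⟩
    cases n with
    | zero =>
      obtain rfl : u = ∅ := (ZFSet.eq_empty u).2 fun w hw => by simpa using (hua w).1 hw
      simp
    | succ n =>
      have hn : f^[n] η ∈ u := (hua _).2 ⟨n, n.lt_succ_self, rfl⟩
      have hne : u ≠ ∅ := fun e => ZFSet.notMem_empty _ (e ▸ hn)
      have hall : ∀ w, w ∈ u → Ψ w (f^[n + 1] η) := fun w hw => by
        obtain ⟨k, hk, rfl⟩ := (hua w).1 hw
        exact haΨ hk
      have hmin : ∀ y', y' ∈ f^[n + 1] η → ¬ ∀ w, w ∈ u → Ψ w y' := fun y' hy' h => by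
        rw [Function.iterate_succ_apply'] at hy'
        exact (hf _ (haθ n)).2.2 y' hy' (h _ hn)
      constructor
      · rintro (⟨h, -⟩ | ⟨-, h1, h2, h3⟩)
        · exact (hne h).elim
        · rcases (hθ.mem h1).mem_trichotomous (hθ.mem (haθ (n + 1))) with h | h | h
          exacts [(hmin y h h2).elim, h, (h3 _ h hall).elim]
      · rintro rfl
        exact Or.inr ⟨hne, haθ _, hall, hmin⟩)
  have hωK := Mdl.omega_mem K
  obtain ⟨u, hu, hus⟩ := Mdl.exists_image hs hωK
  have hua : ∀ w, w ∈ u ↔ ∃ n, w = f^[n] η := by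
    intro w
    rw [hus]
    constructor
    · rintro ⟨x, -, h⟩
      obtain ⟨n, -, h⟩ := (hsa _ _).1 h
      exact ⟨n, h⟩
    · rintro ⟨n, rfl⟩
      exact ⟨nat n, nat_mem_omega n, (hsa _ _).2 ⟨n, rfl, rfl⟩⟩
  have hβm : ∀ w, w ∈ ZFSet.sUnion u ↔ ∃ n, w ∈ f^[n] η := by
    intro w
    rw [ZFSet.mem_sUnion]
    constructor
    · rintro ⟨z, hz, hw⟩
      obtain ⟨n, rfl⟩ := (hua z).1 hz
      exact ⟨n, hw⟩
    · exact fun ⟨n, hn⟩ => ⟨_, (hua _).2 ⟨n, rfl⟩, hn⟩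
  have haβ : ∀ n, f^[n] η ∈ ZFSet.sUnion u := fun n =>
    (hβm _).2 ⟨n + 1, (haΨ n.lt_succ_self).1⟩
  have hβo : (ZFSet.sUnion u).IsOrdinal := isOrdinal_sUnion fun x hx => by
    obtain ⟨n, rfl⟩ := (hua x).1 hx
    exact hθ.mem (haθ n)
  refine ⟨ZFSet.sUnion u, ?_, haβ 0, ⟨ZFSet.omega, by simp, ?_⟩, ?_⟩
  · lift s to K using hs
    have hD : D2 K fun x y => x.pair y ∈ (s : ZFSet) := inferInstance
    obtain ⟨γ, hγ, h⟩ := Mdl.regular_bound hD hθ hθK' hr hω fun x hx => by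
      obtain ⟨n, rfl⟩ := mem_omega_iff.1 hx
      exact ⟨f^[n] η, haθ n, (hsa _ _).2 ⟨n, rfl, rfl⟩⟩
    have hsub : ZFSet.sUnion u ⊆ γ := by
      intro w hw
      obtain ⟨n, hn⟩ := (hβm w).1 hw
      obtain ⟨y, hy, hny⟩ := h _ (nat_mem_omega n)
      obtain ⟨m, hm, rfl⟩ := (hsa _ _).1 hny
      rw [← nat_injective hm] at hy
      exact (hθ.mem hγ).mem_trans hn hy
    rcases (hβo.subset_iff_eq_or_mem (hθ.mem hγ)).1 hsub with h | h
    exacts [h ▸ hγ, hθ.mem_trans h hγ]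
  · lift s to K using hs
    have hD : D2 K fun x y => x.pair y ∈ (s : ZFSet) := inferInstance
    obtain ⟨g, hg, h1, h2⟩ := Mdl.exists_func hD hωK (Mdl.sUnion_mem hu) fun x hx => by
      obtain ⟨n, rfl⟩ := mem_omega_iff.1 hx
      exact ⟨f^[n] η, haβ n, (hsa _ _).2 ⟨n, rfl, rfl⟩⟩
    refine ⟨g, hg, h1, fun γ hγ => ?_⟩
    obtain ⟨n, hn⟩ := (hβm γ).1 hγ
    obtain ⟨y, -, hy⟩ := isFunc_value h1 (nat_mem_omega n)
    obtain ⟨m, hm, rfl⟩ := (hsa _ _).1 (h2 _ _ hy)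
    exact ⟨nat n, nat_mem_omega n, _, hy, Or.inl (nat_injective hm ▸ hn)⟩
  · intro x hx
    obtain ⟨n, hn⟩ := (hβm x).1 hx
    exact ⟨f^[n] η, haβ n, hn, f^[n + 1] η, haβ _, (haΨ n.lt_succ_self).2⟩

end TransModel

namespace TransModel

universe u

variable {M N : Set ZFSet.{u}} {n : ℕ}

open Classical in
/-- The total extension of an embedding, with value `∅` outside its domain. -/
noncomputable def ext (j : M ↪ₑ[ZFLang] N) (x : ZFSet.{u}) : ZFSet.{u} :=
  if h : x ∈ M then j ⟨x, h⟩ else ∅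

variable {j : M ↪ₑ[ZFLang] N}

theorem ext_coe (a : M) : ext j a = j a :=
  dif_pos a.2

theorem ext_mk {x : ZFSet.{u}} (h : x ∈ M) : (j ⟨x, h⟩ : ZFSet) = ext j x :=
  (ext_coe ⟨x, h⟩).symm

theorem ext_mem_right {x : ZFSet.{u}} (h : x ∈ M) : ext j x ∈ N := by
  rw [← ext_mk h]
  exact (j ⟨x, h⟩).2

theorem ext_mem_iff {x y : ZFSet.{u}} (hx : x ∈ M) (hy : y ∈ M) : ext j x ∈ ext j y ↔ x ∈ y := by
  lift x to M using hx
  lift y to M using hy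
  rw [ext_coe, ext_coe]
  exact (Tr.transfer (j := j) inferInstance).symm

theorem ext_inj {x y : ZFSet.{u}} (hx : x ∈ M) (hy : y ∈ M) : ext j x = ext j y ↔ x = y := by
  lift x to M using hx
  lift y to M using hy
  rw [ext_coe, ext_coe]
  exact (Tr.transfer (j := j) inferInstance).symm

variable [Mdl M] [Mdl N]

instance Tm.op_nat {f : M → N} (k : ℕ) :
    Tm f (fun _ : Fin n → ZFSet.{u} => nat k) fun _ => nat k := by
  induction k with
  | zero =>
    rw [nat_zero]
    infer_instance
  | succ k ih =>
    rw [nat_succ]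
    infer_instance

theorem isOrdinal_ext {x : ZFSet.{u}} (hx : x ∈ M) : (ext j x).IsOrdinal ↔ x.IsOrdinal := by
  lift x to M using hx
  rw [ext_coe]
  exact (Tr.transfer (j := j) inferInstance).symm

theorem ext_nat (k : ℕ) : ext j (nat k) = nat k := by
  have h : Tm (n := 0) j (fun _ => nat k) fun _ => nat k := inferInstance
  rw [← ext_mk (h.memL default)]
  exact h.map_eq _

theorem ext_omega : ext j ZFSet.omega = ZFSet.omega := by
  have h : Tm (n := 0) j (fun _ => ZFSet.omega) fun _ => ZFSet.omega := inferInstance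
  rw [← ext_mk (h.memL default)]
  exact h.map_eq _

theorem ext_opair_iff {x y f : ZFSet.{u}} (hf : f ∈ M) (hx : x ∈ M) (hy : y ∈ M) :
    (ext j x).pair (ext j y) ∈ ext j f ↔ x.pair y ∈ f := by
  lift x to M using hx
  lift y to M using hy
  lift f to M using hf
  rw [ext_coe, ext_coe, ext_coe]
  exact (Tr.transfer (j := j) (P := ZFSet.pair x y ∈ (f : ZFSet)) inferInstance).symm

/-- The image of a function, evaluated at a point of the range, has its value in the range. -/
theorem ext_value {x z f : ZFSet.{u}} (hf : f ∈ M) (hx : x ∈ M)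
    (h : ∀ y z, x.pair y ∈ f → x.pair z ∈ f → y = z) (hxz : (ext j x).pair z ∈ ext j f) :
    ∃ y, x.pair y ∈ f ∧ z = ext j y := by
  have hz := (Mdl.of_opair (ext_mem_right hf) hxz).2
  lift x to M using hx
  lift f to M using hf
  rw [ext_coe, ext_coe] at hxz
  obtain ⟨y, hy, hxy⟩ := (Tr.transfer (j := j) (P := ∃ y, y ∈ M ∧ ZFSet.pair x y ∈ (f : ZFSet))
    (Q := ∃ y, y ∈ N ∧ ZFSet.pair (j x) y ∈ (j f : ZFSet)) inferInstance).2 ⟨z, hz, hxz⟩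
  refine ⟨y, hxy, ?_⟩
  lift y to M using hy
  rw [ext_coe]
  exact (Tr.transfer (j := j) (P := ∀ z, z ∈ M → ZFSet.pair x z ∈ (f : ZFSet) → z = y)
    (Q := ∀ z, z ∈ N → ZFSet.pair (j x) z ∈ (j f : ZFSet) → z = j y) inferInstance).1
    (fun w _ hw => h w y hw hxy) z hz hxz

theorem ext_cofinalIn {a b f : ZFSet.{u}} (ha : a ∈ M) (hb : b ∈ M) (hf : f ∈ M) :
    CofinalIn (ext j a) (ext j b) (ext j f) ↔ CofinalIn a b f := by
  lift a to M using ha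
  lift f to M using hf
  lift b to M using hb
  rw [ext_coe, ext_coe, ext_coe]
  exact (Tr.transfer (j := j) inferInstance).symm

/-- An embedding fixing all ordinals is the identity. -/
theorem ext_eq_self (h : ∀ ξ, ξ ∈ M → ξ.IsOrdinal → ext j ξ = ξ) {x : ZFSet.{u}} (hx : x ∈ M) :
    ext j x = x := by
  induction x using ZFSet.inductionOn with
  | _ x ih =>
  ext z
  constructor
  · intro hz
    obtain ⟨δ, F, hδ, hF, hδo, h1, h2, h3, h4, h5⟩ := Mdl.exists_enumeration hx
    have hz' : ∃ ξ, ξ ∈ ext j δ ∧ ξ.pair z ∈ ext j F := by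
      lift x to M using hx
      lift δ to M using hδ
      lift F to M using hF
      rw [ext_coe] at hz ⊢
      rw [ext_coe]
      exact (Tr.transfer (j := j) (P := ∀ z, z ∈ (x : ZFSet) → ∃ ξ, ξ ∈ (δ : ZFSet) ∧
        ξ.pair z ∈ (F : ZFSet)) (Q := ∀ z, z ∈ (j x : ZFSet) → ∃ ξ, ξ ∈ (j δ : ZFSet) ∧
        ξ.pair z ∈ (j F : ZFSet)) inferInstance).1 (fun z hz => by
          obtain ⟨ξ, hξ⟩ := h3 z hz
          exact ⟨ξ, (h1 _ _ hξ).1, hξ⟩) z hz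
    obtain ⟨ξ, hξ, hξz⟩ := hz'
    rw [h δ hδ hδo] at hξ
    have hξM := Mdl.trans M hδ hξ
    rw [← h ξ hξM (hδo.mem hξ)] at hξz
    obtain ⟨y, hy, rfl⟩ := ext_value hF hξM (h4 ξ) hξz
    have hyx := (h1 _ _ hy).2
    rwa [ih y hyx (Mdl.trans M hx hyx)]
  · intro hz
    have hzM := Mdl.trans M hx hz
    rw [← ih z hz hzM]
    exact (ext_mem_iff hzM hx).2 hz

theorem exists_isCrit (hnt : ∃ x : M, ((j x : N) : ZFSet.{u}) ≠ x) : ∃ κ, IsCrit M N j κ := by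
  have : ∃ ξ, ξ ∈ M ∧ ξ.IsOrdinal ∧ ext j ξ ≠ ξ := by
    by_contra! h
    obtain ⟨x, hx⟩ := hnt
    exact hx (by rw [← ext_coe]; exact ext_eq_self h x.2)
  obtain ⟨ξ, hξ, ho, hne⟩ := this
  obtain ⟨κ, h1, h2, h3, h4⟩ := exists_least (P := fun ξ => ext j ξ ≠ ξ) ho hne
  have hκ : κ ∈ M := by
    rcases h3 with rfl | h3
    exacts [hξ, Mdl.trans M hξ h3]
  refine ⟨κ, h1, hκ, by rwa [ext_mk], fun β hβ hb => ?_⟩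
  rw [ext_mk]
  exact not_not.1 (h4 β hβ)

section ordinals

variable (hOrd : SameOrdinals M N)
include hOrd

theorem ext_mem_left {x : ZFSet.{u}} (hx : x ∈ M) (ho : x.IsOrdinal) : ext j x ∈ M :=
  (hOrd _ ((isOrdinal_ext hx).2 ho)).2 (ext_mem_right hx)

theorem ext_notMem {x : ZFSet.{u}} (hx : x ∈ M) (ho : x.IsOrdinal) : ext j x ∉ x := by
  induction x using ZFSet.inductionOn with
  | _ x ih =>
  intro h
  have hM := ext_mem_left (j := j) hOrd hx ho
  exact ih _ h hM (ho.mem h) ((ext_mem_iff hM hx).2 h)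

theorem subset_ext {x : ZFSet.{u}} (hx : x ∈ M) (ho : x.IsOrdinal) : x ⊆ ext j x := by
  have ho' := (isOrdinal_ext (j := j) hx).2 ho
  rw [ho.subset_iff_eq_or_mem ho']
  rcases ho.mem_trichotomous ho' with h | h | h
  exacts [Or.inr h, Or.inl h, (ext_notMem hOrd hx ho h).elim]

end ordinals

end TransModel

namespace TransModel

universe u

variable {M N : Set ZFSet.{u}} {j : M ↪ₑ[ZFLang] N} {κ α : ZFSet.{u}}

theorem _root_.IsCrit.ext_ne (h : IsCrit M N j κ) : ext j κ ≠ κ := by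
  rw [← ext_mk h.2.1]
  exact h.2.2.1

variable [Mdl M]

theorem _root_.IsCrit.ext_eq (h : IsCrit M N j κ) {ξ : ZFSet.{u}} (hξ : ξ ∈ κ) : ext j ξ = ξ := by
  have := Mdl.trans M h.2.1 hξ
  rw [← ext_mk this]
  exact h.2.2.2 ξ hξ this

theorem imageSet_iff {x z : ZFSet.{u}} (hx : x ∈ M) :
    ImageSet M N j x z ↔ ∀ w, w ∈ z ↔ ∃ y, y ∈ x ∧ w = ext j y := by
  refine forall_congr' fun w => iff_congr Iff.rfl ⟨?_, ?_⟩
  · rintro ⟨y, hy, rfl⟩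
    exact ⟨y, hy, (ext_coe y).symm⟩
  · rintro ⟨y, hy, rfl⟩
    exact ⟨⟨y, Mdl.trans M hx hy⟩, hy, ext_mk _⟩

variable [Mdl N]

theorem _root_.IsCrit.mem_ext (h : IsCrit M N j κ) (hOrd : SameOrdinals M N) : κ ∈ ext j κ := by
  rcases (h.1.subset_iff_eq_or_mem ((isOrdinal_ext h.2.1).2 h.1)).1 (subset_ext hOrd h.2.1 h.1)
    with h' | h'
  exacts [(h.ext_ne h'.symm).elim, h']

theorem _root_.IsCrit.omega_mem (h : IsCrit M N j κ) : ZFSet.omega ∈ κ := by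
  rcases isOrdinal_omega.mem_trichotomous h.1 with h' | h' | h'
  · exact h'
  · exact (h.ext_ne (h' ▸ ext_omega)).elim
  · obtain ⟨n, rfl⟩ := mem_omega_iff.1 h'
    exact (h.ext_ne (ext_nat n)).elim

/-- The critical point is not an image of an ordinal. -/
theorem _root_.IsCrit.ne_ext (h : IsCrit M N j κ) (hOrd : SameOrdinals M N) {ξ : ZFSet.{u}}
    (hξ : ξ ∈ M)
    (ho : ξ.IsOrdinal) : κ ≠ ext j ξ := by
  intro he
  rcases ho.mem_trichotomous h.1 with h' | rfl | h'
  · rw [h.ext_eq h'] at he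
    exact ZFSet.mem_irrefl _ (he ▸ h')
  · exact h.ext_ne he.symm
  · have := (ext_mem_iff (j := j) h.2.1 hξ).2 h'
    rw [← he] at this
    exact ZFSet.mem_asymm this (h.mem_ext hOrd)

theorem _root_.IsCrit.iterate (h : IsCrit M N j κ) (hOrd : SameOrdinals M N) (n : ℕ) :
    ((ext j)^[n] κ).IsOrdinal ∧ (ext j)^[n] κ ∈ M ∧ (ext j)^[n] κ ∈ (ext j)^[n + 1] κ := by
  induction n with
  | zero => exact ⟨h.1, h.2.1, h.mem_ext hOrd⟩
  | succ n ih =>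
    simp only [Function.iterate_succ_apply'] at ih ⊢
    obtain ⟨h1, h2, h3⟩ := ih
    have h4 := ext_mem_left (j := j) hOrd h2 h1
    exact ⟨(isOrdinal_ext h2).2 h1, h4, (ext_mem_iff h2 h4).2 h3⟩

theorem _root_.IsCrit.iterate_mem (h : IsCrit M N j κ) (hOrd : SameOrdinals M N)
    {k n : ℕ} (hkn : k < n) :
    (ext j)^[k] κ ∈ (ext j)^[n] κ := by
  induction hkn with
  | refl => exact (h.iterate hOrd k).2.2
  | step _ ih => exact (h.iterate hOrd _).1.mem_trans ih (h.iterate hOrd _).2.2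

/-- The restriction of the embedding to an ordinal belongs to `N` if the pointwise image does. -/
theorem exists_graph (hOrd : SameOrdinals M N) (hα : α.IsOrdinal) (hαM : α ∈ M)
    (h : ∃ z ∈ N, ImageSet M N j α z) :
    ∃ e, e ∈ N ∧ ∀ x y, x.pair y ∈ e ↔ x ∈ α ∧ y = ext j x := by
  obtain ⟨z, hz, hzj⟩ := h
  rw [imageSet_iff hαM] at hzj
  lift z to N using hz
  have hD : D2 N fun u y => (y ∈ (z : ZFSet) ∧ ¬ y ∈ u) ∧
    ∀ y', y' ∈ y → ¬ (y' ∈ (z : ZFSet) ∧ ¬ y' ∈ u) := inferInstance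
  refine Mdl.recursion hD hα ((hOrd α hα).1 hαM) fun ξ hξ u hu huj => ?_
  have hξM := Mdl.trans M hαM hξ
  refine ⟨ext_mem_right hξM, fun y hy => ⟨?_, ?_⟩⟩
  · rintro ⟨⟨h1, h2⟩, h3⟩
    obtain ⟨ζ, hζ, rfl⟩ := (hzj y).1 h1
    rcases (hα.mem hζ).mem_trichotomous (hα.mem hξ) with h | rfl | h
    · exact (h2 ((huj _).2 ⟨ζ, h, rfl⟩)).elim
    · rfl
    · refine (h3 (ext j ξ) ((ext_mem_iff hξM (Mdl.trans M hαM hζ)).2 h) ⟨(hzj _).2 ⟨ξ, hξ, rfl⟩,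
        fun hm => ?_⟩).elim
      obtain ⟨ρ, hρ, he⟩ := (huj _).1 hm
      rw [ext_inj hξM (Mdl.trans M hξM hρ)] at he
      exact ZFSet.mem_irrefl _ (he ▸ hρ)
  · rintro rfl
    refine ⟨⟨(hzj _).2 ⟨ξ, hξ, rfl⟩, fun hm => ?_⟩, fun y' hy' h => ?_⟩
    · obtain ⟨ρ, hρ, he⟩ := (huj _).1 hm
      rw [ext_inj hξM (Mdl.trans M hξM hρ)] at he
      exact ZFSet.mem_irrefl _ (he ▸ hρ)
    · obtain ⟨ζ, hζ, rfl⟩ := (hzj y').1 h.1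
      exact h.2 ((huj _).2 ⟨ζ, (ext_mem_iff (Mdl.trans M hαM hζ) hξM).1 hy', rfl⟩)

/-- The supremum of the critical sequence has countable cofinality in `N`. -/
theorem _root_.IsCrit.cw_right (h : IsCrit M N j κ) (hOrd : SameOrdinals M N) {l : ZFSet.{u}}
    (hl : l.IsOrdinal) (hlM : l ∈ M) (him : ∃ z ∈ N, ImageSet M N j l z)
    (hmem : ∀ n, (ext j)^[n] κ ∈ l) (hcof : ∀ γ ∈ l, ∃ n, γ ∈ (ext j)^[n] κ ∨ γ = (ext j)^[n] κ) :
    Cw N l := by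
  obtain ⟨e, he, hej⟩ := exists_graph hOrd hl hlM him
  have hlN := (hOrd l hl).1 hlM
  have hκN := (hOrd κ h.1).1 h.2.1
  have hlN' := hlN
  lift e to N using he
  lift l to N using hlN
  set c : N := ⟨κ, hκN⟩ with hc
  have hD : D2 N fun u y => y ∈ (l : ZFSet) ∧ ((u = ∅ ∧ y = (c : ZFSet)) ∨ (¬ u = ∅ ∧
    ((∀ w, w ∈ u → ∀ v, v ∈ (l : ZFSet) → w.pair v ∈ (e : ZFSet) → v ∈ y ∨ v = y) ∧
      ∃ w, w ∈ u ∧ w.pair y ∈ (e : ZFSet)))) := inferInstance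
  obtain ⟨s, hs, hsj⟩ := Mdl.exists_sequence hD (a := fun n => (ext j)^[n] κ) (by
    intro n u hu huj
    refine ⟨Mdl.trans N hlN' (hmem n), fun y hy => ?_⟩
    cases n with
    | zero =>
      obtain rfl : u = ∅ := (ZFSet.eq_empty u).2 fun w hw => by simpa using (huj w).1 hw
      constructor
      · rintro ⟨-, ⟨-, h⟩ | ⟨h, -⟩⟩
        exacts [h, (h rfl).elim]
      · rintro rfl
        exact ⟨hmem 0, Or.inl ⟨rfl, rfl⟩⟩
    | succ n =>
      have hn : (ext j)^[n] κ ∈ u := (huj _).2 ⟨n, n.lt_succ_self, rfl⟩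
      have hne : u ≠ ∅ := fun e => ZFSet.notMem_empty _ (e ▸ hn)
      have hpe : ∀ k, ((ext j)^[k] κ).pair ((ext j)^[k + 1] κ) ∈ (e : ZFSet) := fun k =>
        (hej _ _).2 ⟨hmem k, Function.iterate_succ_apply' _ _ _⟩
      constructor
      · rintro ⟨-, ⟨h, -⟩ | ⟨-, h1, w, hw, hwy⟩⟩
        · exact (hne h).elim
        · have h2 := h1 _ hn _ (hmem (n + 1)) (hpe n)
          obtain ⟨k, hk, rfl⟩ := (huj w).1 hw
          obtain rfl := ((hej _ _).1 hwy).2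
          rw [← Function.iterate_succ_apply' (ext j)] at h2 ⊢
          rcases (Nat.succ_le_of_lt hk).lt_or_eq with hk | hk
          · have := h.iterate_mem hOrd hk
            rcases h2 with h2 | h2
            exacts [(ZFSet.mem_asymm this h2).elim, h2.symm]
          · rw [← hk]
      · rintro rfl
        refine ⟨hmem _, Or.inr ⟨hne, fun w hw v _ hwv => ?_, _, hn, hpe n⟩⟩
        obtain ⟨k, hk, rfl⟩ := (huj w).1 hw
        obtain rfl := ((hej _ _).1 hwv).2
        rw [← Function.iterate_succ_apply' (ext j)]
        rcases (Nat.succ_le_of_lt hk).lt_or_eq with hk | hk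
        · exact Or.inl (h.iterate_mem hOrd hk)
        · rw [← hk]
          exact Or.inr rfl)
  lift s to N using hs
  have hD : D2 N fun x y => x.pair y ∈ (s : ZFSet) := inferInstance
  obtain ⟨g, hg, h1, h2⟩ := Mdl.exists_func hD (Mdl.omega_mem N) hlN' fun x hx => by
    obtain ⟨n, rfl⟩ := mem_omega_iff.1 hx
    exact ⟨_, hmem n, (hsj _ _).2 ⟨n, rfl, rfl⟩⟩
  refine ⟨ZFSet.omega, by simp, g, hg, h1, fun γ hγ => ?_⟩
  obtain ⟨n, hn⟩ := hcof γ hγ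
  obtain ⟨y, -, hy⟩ := isFunc_value h1 (nat_mem_omega n)
  obtain ⟨m, hm, rfl⟩ := (hsj _ _).1 (h2 _ _ hy)
  exact ⟨nat n, nat_mem_omega n, _, hy, nat_injective hm ▸ hn⟩

end TransModel

namespace TransModel

universe u

variable {M N : Set ZFSet.{u}} [Mdl M] [Mdl N] {j : M ↪ₑ[ZFLang] N} {κ : ZFSet.{u}}

/-- Functions between ordinals in `M` can be decoded in `N` from their images. -/
theorem exists_func_right (hOrd : SameOrdinals M N)
    (hA : ∀ α : ZFSet, α.IsOrdinal → α ∈ M → ∃ z ∈ N, ImageSet M N j α z) {δ γ g : ZFSet.{u}}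
    (hδ : δ.IsOrdinal) (hδM : δ ∈ M) (hγ : γ.IsOrdinal) (hγM : γ ∈ M) (hgM : g ∈ M)
    (hg : ZFSet.IsFunc δ γ g) :
    ∃ f, f ∈ N ∧ ZFSet.IsFunc δ γ f ∧ ∀ x y, ZFSet.pair x y ∈ f → ZFSet.pair x y ∈ g := by
  obtain ⟨d, hd, hdj⟩ := exists_graph hOrd hδ hδM (hA δ hδ hδM)
  obtain ⟨e, he, hej⟩ := exists_graph hOrd hγ hγM (hA γ hγ hγM)
  have hG : ext j g ∈ N := ext_mem_right hgM
  have key : ∀ x y, x.pair (ext j x) ∈ d → y.pair (ext j y) ∈ e →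
      ((ext j x).pair (ext j y) ∈ ext j g ↔ x.pair y ∈ g) := fun x y hx hy =>
    ext_opair_iff hgM (Mdl.trans M hδM ((hdj _ _).1 hx).1) (Mdl.trans M hγM ((hej _ _).1 hy).1)
  generalize ext j g = G at hG key
  lift d to N using hd
  lift e to N using he
  lift G to N using hG
  have hD : D2 N fun x y => ∃ x', x' ∈ N ∧ (x.pair x' ∈ (d : ZFSet) ∧ ∃ y', y' ∈ N ∧
    (y.pair y' ∈ (e : ZFSet) ∧ x'.pair y' ∈ (G : ZFSet))) := inferInstance
  obtain ⟨f, hf, h1, h2⟩ := Mdl.exists_func hD ((hOrd δ hδ).1 hδM) ((hOrd γ hγ).1 hγM)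
    fun x hx => by
      obtain ⟨y, hy, hxy⟩ := isFunc_value hg hx
      have h1 := (hdj x _).2 ⟨hx, rfl⟩
      have h2 := (hej y _).2 ⟨hy, rfl⟩
      exact ⟨y, hy, _, ext_mem_right (Mdl.trans M hδM hx), h1, _,
        ext_mem_right (Mdl.trans M hγM hy), h2, (key x y h1 h2).2 hxy⟩
  refine ⟨f, hf, h1, fun x y hxy => ?_⟩
  obtain ⟨x', -, h3, y', -, h4, h5⟩ := h2 x y hxy
  obtain rfl := ((hdj _ _).1 h3).2
  obtain rfl := ((hej _ _).1 h4).2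
  exact (key x y h3 h4).1 h5

/-- If regularity is upward absolute, then countable cofinality is downward absolute. -/
theorem Cw.left (hOrd : SameOrdinals M N)
    (hA : ∀ α : ZFSet, α.IsOrdinal → α ∈ M → ∃ z ∈ N, ImageSet M N j α z)
    (hreg : ∀ α : ZFSet, α.IsOrdinal → α ∈ M → RegularIn M α → RegularIn N α) {γ : ZFSet.{u}}
    (hγ : γ.IsOrdinal) (hγM : γ ∈ M) (h : Cw N γ) : Cw M γ := by
  obtain ⟨δ, g, hδM, hgM, hδ, -, hg, hgc, hr, hmin⟩ := Mdl.exists_cofinality hγ hγM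
  rcases isOrdinal_omega.mem_trichotomous hδ with hω | hω | hω
  · obtain ⟨ρ, hρ, t, ht, htf, htc⟩ := h
    have hρδ : ρ ∈ δ := by
      rcases ZFSet.mem_insert_iff.1 hρ with rfl | hρ
      exacts [hω, hδ.mem_trans hρ hω]
    obtain ⟨f, hf, hff, hfg⟩ := exists_func_right hOrd hA hδ hδM hγ hγM hgM hg
    have hγN := (hOrd γ hγ).1 hγM
    lift f to N using hf
    lift t to N using ht
    obtain ⟨c, hc⟩ : ∃ c : N, (c : ZFSet) = γ := ⟨⟨γ, hγN⟩, rfl⟩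
    have hD : D2 N fun ξ ζ => ∃ v, v ∈ (c : ZFSet) ∧ (ξ.pair v ∈ (t : ZFSet) ∧
      ∃ w, w ∈ (c : ZFSet) ∧ (ζ.pair w ∈ (f : ZFSet) ∧ (v ∈ w ∨ v = w))) := inferInstance
    obtain ⟨σ, hσ, hb⟩ := Mdl.regular_bound hD hδ ((hOrd δ hδ).1 hδM) (hreg δ hδ hδM hr) hρδ
      fun ξ hξ => by
        obtain ⟨v, hv, hξv⟩ := isFunc_value htf hξ
        obtain ⟨ζ, hζ, w, hζw, hvw⟩ := hgc v hv
        obtain ⟨w', hw', hζw'⟩ := isFunc_value hff hζ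
        obtain rfl := isFunc_unique hg hζw (hfg _ _ hζw')
        rw [hc]
        exact ⟨ζ, hζ, v, hv, hξv, w, hw', hζw', hvw⟩
    obtain ⟨τ, hτ, hbd⟩ := Mdl.exists_bound hγ hγM (Mdl.trans M hδM hσ) hgM hg
      (hδ.subset_of_mem hσ) (hmin σ hσ)
    obtain ⟨ξ, hξ, η, hξη, hle⟩ := htc τ hτ
    obtain ⟨ζ, hζ, v, hv, hξv, w, hw, hζw, hvw⟩ := hb ξ hξ
    rw [hc] at hw
    obtain rfl := isFunc_unique htf hξη hξv
    have hwτ := hbd ζ hζ w (hfg _ _ hζw)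
    have hηw : η ∈ τ := by
      rcases hvw with hvw | rfl
      exacts [(hγ.mem hτ).mem_trans hvw hwτ, hwτ]
    rcases hle with hle | rfl
    exacts [(ZFSet.mem_asymm hle hηw).elim, (ZFSet.mem_irrefl _ hηw).elim]
  · exact ⟨δ, by simp [hω], g, hgM, hg, hgc⟩
  · exact ⟨δ, by simp [hω], g, hgM, hg, hgc⟩

/-- Embeddings are continuous at ordinals of countable cofinality. -/
theorem Cw.exists_ext {l b : ZFSet.{u}} (hlM : l ∈ M) (hcw : Cw M l) (hb : b ∈ ext j l) :
    ∃ y, y ∈ l ∧ (b ∈ ext j y ∨ b = ext j y) := by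
  obtain ⟨δ, hδ, g, hgM, hg, hgc⟩ := hcw
  have hδM : δ ∈ M ∧ ext j δ = δ := by
    rcases ZFSet.mem_insert_iff.1 hδ with rfl | hδ
    · exact ⟨Mdl.omega_mem M, ext_omega⟩
    · obtain ⟨n, rfl⟩ := mem_omega_iff.1 hδ
      exact ⟨Mdl.trans M (Mdl.omega_mem M) hδ, ext_nat n⟩
  obtain ⟨ξ, hξ, η, hξη, hle⟩ := (ext_cofinalIn hδM.1 hlM hgM).2 hgc b hb
  rw [hδM.2] at hξ
  have hξω : ξ ∈ ZFSet.omega := by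
    rcases ZFSet.mem_insert_iff.1 hδ with rfl | hδ
    exacts [hξ, isOrdinal_omega.mem_trans hξ hδ]
  obtain ⟨n, rfl⟩ := mem_omega_iff.1 hξω
  rw [← ext_nat (j := j) n] at hξη
  obtain ⟨y, hy, rfl⟩ := ext_value hgM (Mdl.trans M hδM.1 hξ) (fun _ _ => isFunc_unique hg) hξη
  exact ⟨y, isFunc_cod hg hy, hle⟩

/-- The supremum of the critical sequence is a fixed point if it has countable cofinality. -/
theorem ext_sup_iterate (hOrd : SameOrdinals M N) {l : ZFSet.{u}}
    (hl : l.IsOrdinal) (hlM : l ∈ M) (hmem : ∀ n, (ext j)^[n] κ ∈ l)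
    (hcof : ∀ γ ∈ l, ∃ n, γ ∈ (ext j)^[n] κ ∨ γ = (ext j)^[n] κ) (hcw : Cw M l) :
    ext j l = l := by
  rcases (hl.subset_iff_eq_or_mem ((isOrdinal_ext (j := j) hlM).2 hl)).1 (subset_ext hOrd hlM hl)
    with h | h
  · exact h.symm
  obtain ⟨y, hy, hle⟩ := hcw.exists_ext hlM h
  have hjy : ext j y ∈ l := by
    have hyM := Mdl.trans M hlM hy
    obtain ⟨k, hk⟩ := hcof y hy
    have hk' := hmem (k + 1)
    rw [Function.iterate_succ_apply'] at hk'
    rcases hk with hk | rfl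
    · exact hl.mem_trans ((ext_mem_iff hyM (Mdl.trans M hlM (hmem k))).2 hk) hk'
    · exact hk'
  rcases hle with hle | hle
  exacts [(ZFSet.mem_asymm hle hjy).elim, (ZFSet.mem_irrefl _ (hle ▸ hjy)).elim]

/-- Above a fixed ordinal there is a fixed regular ordinal. -/
theorem exists_regular_fixed (hOrd : SameOrdinals M N)
    (hreg : ∀ α : ZFSet, α.IsOrdinal → α ∈ M → RegularIn M α → RegularIn N α) {l : ZFSet.{u}}
    (hl : l.IsOrdinal) (hlM : l ∈ M) (hj : ext j l = l) :
    ∃ θ, θ ∈ M ∧ θ.IsOrdinal ∧ RegularIn M θ ∧ l ∈ θ ∧ ext j θ = θ := by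
  obtain ⟨σ, hσM, hσ, hσr, hlσ⟩ := Mdl.exists_regular hl hlM
  obtain ⟨θ, hθ, ⟨hr, hlθ⟩, hle, hmin⟩ :=
    exists_least (P := fun θ => RegularIn M θ ∧ l ∈ θ) hσ ⟨hσr, hlσ⟩
  have hθM : θ ∈ M := by
    rcases hle with rfl | h
    exacts [hσM, Mdl.trans M hσM h]
  refine ⟨θ, hθM, hθ, hr, hlθ, ?_⟩
  have hmin' : ∀ ξ, ξ ∈ ext j θ → ¬ (RegularIn N ξ ∧ ext j l ∈ ξ) := by
    lift θ to M using hθM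
    lift l to M using hlM
    rw [ext_coe, ext_coe]
    exact (Tr.transfer (j := j) (P := ∀ ξ, ξ ∈ (θ : ZFSet) → ¬ (RegularIn M ξ ∧ (l : ZFSet) ∈ ξ))
      (Q := ∀ ξ, ξ ∈ (j θ : ZFSet) → ¬ (RegularIn N ξ ∧ (j l : ZFSet) ∈ ξ)) inferInstance).1 hmin
  rw [hj] at hmin'
  rcases (hθ.subset_iff_eq_or_mem ((isOrdinal_ext (j := j) hθM).2 hθ)).1 (subset_ext hOrd hθM hθ)
    with h | h
  exacts [h.symm, (hmin' θ h ⟨hreg θ hθ hθM hr, hlθ⟩).elim]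

end TransModel

namespace TransModel

universe u

/-- `C` is an `ω`-club subset of `θ` in the model `K`. -/
def OmegaClub (K : Set ZFSet.{u}) (θ C : ZFSet.{u}) : Prop :=
  (∀ z, z ∈ C → z ∈ θ) ∧ ((∀ ξ, ξ ∈ θ → ∃ z, z ∈ C ∧ ξ ∈ z) ∧
    ∀ β, β ∈ θ → Cw K β → (∀ x, x ∈ β → ∃ z, z ∈ C ∧ (x ∈ z ∧ z ∈ β)) → β ∈ C)

/-- Every `ω`-club subset of `θ` contains a point whose ladder in `c` passes through `γ`. -/
def Guessed (K : Set ZFSet.{u}) (θ c γ : ZFSet.{u}) : Prop :=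
  ∀ C, C ∈ K → OmegaClub K θ C → ∃ β, β ∈ C ∧ ∃ g, g ∈ K ∧ (β.pair g ∈ c ∧
    ∃ i, i ∈ ZFSet.omega ∧ i.pair γ ∈ g)

section tr

variable {M N : Set ZFSet.{u}} [Mdl M] [Mdl N] {j : M → N} {n : ℕ}
  {t s t' s' t'' s'' : (Fin n → ZFSet.{u}) → ZFSet.{u}}

instance Tr.omegaClub [ht : Tm j t s] [ht' : Tm j t' s'] :
    Tr j (fun v => OmegaClub M (t v) (t' v)) fun v => OmegaClub N (s v) (s' v) :=
  Tr.subst2 (P := OmegaClub M) (Q := OmegaClub N)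
    (inferInstanceAs (Tr j (fun w : Fin 2 → ZFSet.{u} =>
      (∀ z, z ∈ w 1 → z ∈ w 0) ∧ ((∀ ξ, ξ ∈ w 0 → ∃ z, z ∈ w 1 ∧ ξ ∈ z) ∧
        ∀ β, β ∈ w 0 → Cw M β → (∀ x, x ∈ β → ∃ z, z ∈ w 1 ∧ (x ∈ z ∧ z ∈ β)) → β ∈ w 1))
      fun w : Fin 2 → ZFSet.{u} =>
      (∀ z, z ∈ w 1 → z ∈ w 0) ∧ ((∀ ξ, ξ ∈ w 0 → ∃ z, z ∈ w 1 ∧ ξ ∈ z) ∧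
        ∀ β, β ∈ w 0 → Cw N β → (∀ x, x ∈ β → ∃ z, z ∈ w 1 ∧ (x ∈ z ∧ z ∈ β)) → β ∈ w 1))) ht ht'

instance Tr.guessed [ht : Tm j t s] [ht' : Tm j t' s'] [ht'' : Tm j t'' s''] :
    Tr j (fun v => Guessed M (t v) (t' v) (t'' v)) fun v => Guessed N (s v) (s' v) (s'' v) :=
  Tr.subst3 (P := Guessed M) (Q := Guessed N)
    (inferInstanceAs (Tr j (fun w : Fin 3 → ZFSet.{u} =>
      ∀ C, C ∈ M → OmegaClub M (w 0) C → ∃ β, β ∈ C ∧ ∃ g, g ∈ M ∧ (β.pair g ∈ w 1 ∧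
        ∃ i, i ∈ ZFSet.omega ∧ i.pair (w 2) ∈ g))
      fun w : Fin 3 → ZFSet.{u} =>
      ∀ C, C ∈ N → OmegaClub N (w 0) C → ∃ β, β ∈ C ∧ ∃ g, g ∈ N ∧ (β.pair g ∈ w 1 ∧
        ∃ i, i ∈ ZFSet.omega ∧ i.pair (w 2) ∈ g))) ht ht' ht''

end tr

variable {K : Set ZFSet.{u}} [Mdl K] {θ c η : ZFSet.{u}}

/-- There is a choice of cofinal `ω`-sequences in the model. -/
theorem Mdl.exists_ladder (hθ : θ ∈ K) :
    ∃ c, c ∈ K ∧ Fn c ∧ (∀ β ∈ θ, Cw K β → ∃ g, β.pair g ∈ c) ∧ ∀ β g, β.pair g ∈ c → β ∈ θ ∧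
      ∃ δ, δ ∈ insert ZFSet.omega.{u} ZFSet.omega.{u} ∧
        (ZFSet.IsFunc δ β g ∧ CofinalIn δ β g) := by
  have hD : D1 K fun β => Cw K β := inferInstance
  have ha := Mdl.sep_mem hD hθ
  have hD : D2 K fun β g => ∃ δ, δ ∈ insert ZFSet.omega.{u} ZFSet.omega.{u} ∧
    (ZFSet.IsFunc δ β g ∧ CofinalIn δ β g) := inferInstance
  obtain ⟨c, hc, h1, h2, h3⟩ := Mdl.uniformization hD ha fun β hβ => by
    obtain ⟨δ, hδ, g, hg, h⟩ := (ZFSet.mem_sep.1 hβ).2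
    exact ⟨g, hg, δ, hδ, h⟩
  exact ⟨c, hc, h1, fun β hβ h => h2 β (ZFSet.mem_sep.2 ⟨hβ, h⟩), fun β g h =>
    ⟨(ZFSet.mem_sep.1 (h3 β g h).1).1, (h3 β g h).2⟩⟩

theorem Mdl.exists_guessed (hθ : θ.IsOrdinal) (hθK : θ ∈ K) (hr : RegularIn K θ)
    (hω : ZFSet.omega ∈ θ) (hc : c ∈ K) (hc1 : ∀ β ∈ θ, Cw K β → ∃ g, β.pair g ∈ c)
    (hc2 : ∀ β g, β.pair g ∈ c → β ∈ θ ∧ ∃ δ, δ ∈ insert ZFSet.omega.{u} ZFSet.omega.{u} ∧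
      (ZFSet.IsFunc δ β g ∧ CofinalIn δ β g)) (hη : η ∈ θ) :
    ∃ γ, γ ∈ θ ∧ γ ∉ η ∧ Guessed K θ c γ := by
  by_contra! hbad
  simp only [Guessed, not_forall] at hbad
  have hηK := Mdl.trans K hθK hη
  have hc' := hc
  have hθK' := hθK
  lift c to K using hc
  lift θ to K using hθK
  have hη' := hη
  lift η to K using hηK
  have hD : D1 K fun γ => ¬ γ ∈ (η : ZFSet) := inferInstance
  have ha := Mdl.sep_mem hD hθK'
  have hD : D2 K fun γ C => OmegaClub K θ C ∧ ¬ ∃ β, β ∈ C ∧ ∃ g, g ∈ K ∧ (β.pair g ∈ (c : ZFSet) ∧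
    ∃ i, i ∈ ZFSet.omega ∧ i.pair γ ∈ g) := inferInstance
  obtain ⟨f, hfK, hf, hf1, hf2⟩ := Mdl.uniformization hD ha fun γ hγ => by
    obtain ⟨C, h1, h2, h3⟩ := hbad γ (ZFSet.mem_sep.1 hγ).1 (ZFSet.mem_sep.1 hγ).2
    exact ⟨C, h1, h2, h3⟩
  have hf1' : ∀ γ ∈ (θ : ZFSet), γ ∉ (η : ZFSet) → ∃ C, C ∈ K ∧ γ.pair C ∈ f := fun γ h1 h2 => by
    obtain ⟨C, hC⟩ := hf1 γ (ZFSet.mem_sep.2 ⟨h1, h2⟩)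
    exact ⟨C, (Mdl.of_opair hfK hC).2, hC⟩
  lift f to K using hfK
  have hΦ : D2 K fun α x => ∀ γ, γ ∈ α → ¬ γ ∈ (η : ZFSet) → ∃ C, C ∈ K ∧
    (γ.pair C ∈ (f : ZFSet) ∧ ∃ z, z ∈ C ∧ (α ∈ z ∧ z ∈ x)) := inferInstance
  obtain ⟨β, hβ, hηβ, hβc, hcl⟩ := Mdl.exists_closure_point hΦ hθ hθK' hr hω hη
    (fun α hα => by
      have hα' := hα
      have hlim := Mdl.regular_limit hθ hθK' hr hω hα
      lift α to K using Mdl.trans K hθK' hα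
      have hD : D2 K fun γ z => (α : ZFSet) ∈ z ∧ (¬ γ ∈ (η : ZFSet) → ∃ C, C ∈ K ∧
        (γ.pair C ∈ (f : ZFSet) ∧ z ∈ C)) := inferInstance
      obtain ⟨δ, hδ, hb⟩ := Mdl.regular_bound hD hθ hθK' hr hα fun γ hγ => by
        by_cases hγη : γ ∈ (η : ZFSet)
        · obtain ⟨z, hz, hαz⟩ := hlim
          exact ⟨z, hz, hαz, fun h => (h hγη).elim⟩
        · obtain ⟨C, hCK, hC⟩ := hf1' γ (hθ.mem_trans hγ hα) hγη
          obtain ⟨z, hz, hαz⟩ := (hf2 _ _ hC).2.1.2.1 α hα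
          exact ⟨z, (hf2 _ _ hC).2.1.1 z hz, hαz, fun _ => ⟨C, hCK, hC, hz⟩⟩
      obtain ⟨x, hx, hαx, hδx⟩ : ∃ x, x ∈ (θ : ZFSet) ∧ (α : ZFSet) ∈ x ∧ δ ⊆ x := by
        rcases (hθ.mem hα).mem_trichotomous (hθ.mem hδ) with h | h | h
        · exact ⟨δ, hδ, h, fun _ h => h⟩
        · obtain ⟨x, hx, hαx⟩ := hlim
          exact ⟨x, hx, hαx, h ▸ (hθ.mem hx).subset_of_mem hαx⟩
        · obtain ⟨x, hx, hαx⟩ := hlim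
          exact ⟨x, hx, hαx, (hθ.mem hx).subset_of_mem ((hθ.mem hx).mem_trans h hαx)⟩
      refine ⟨x, hx, hαx, fun γ hγ hγη => ?_⟩
      obtain ⟨z, hz, hαz, h⟩ := hb γ hγ
      obtain ⟨C, hCK, hC, hzC⟩ := h hγη
      exact ⟨C, hCK, hC, z, hzC, hαz, hδx hz⟩)
    (fun α x y hxy hy h γ hγ hγη => by
      obtain ⟨C, hCK, hC, z, hz, hαz, hzx⟩ := h γ hγ hγη
      exact ⟨C, hCK, hC, z, hz, hαz, (hθ.mem hy).mem_trans hzx hxy⟩)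
  have hβo := hθ.mem hβ
  have hmem : ∀ γ C, γ ∈ β → γ.pair C ∈ (f : ZFSet) → β ∈ C := by
    intro γ C hγ hC
    obtain ⟨ha, hclub, -⟩ := hf2 _ _ hC
    have hγη := (ZFSet.mem_sep.1 ha).2
    refine hclub.2.2 β hβ hβc fun x hx => ?_
    obtain ⟨m, hm, hxm, hγm⟩ : ∃ m, m ∈ β ∧ (x ∈ m ∨ x = m) ∧ (γ ∈ m ∨ γ = m) := by
      rcases (hβo.mem hx).mem_trichotomous (hβo.mem hγ) with h | h | h
      exacts [⟨γ, hγ, Or.inl h, Or.inr rfl⟩, ⟨γ, hγ, Or.inr h, Or.inr rfl⟩,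
        ⟨x, hx, Or.inr rfl, Or.inl h⟩]
    obtain ⟨α, hα, hmα, y, hy, hΦα⟩ := hcl m hm
    have hαo := hβo.mem hα
    have hγα : γ ∈ α := by
      rcases hγm with h | rfl
      exacts [hαo.mem_trans h hmα, hmα]
    have hxα : x ∈ α := by
      rcases hxm with h | rfl
      exacts [hαo.mem_trans h hmα, hmα]
    obtain ⟨C', -, hC', z, hz, hαz, hzy⟩ := hΦα γ hγα hγη
    obtain rfl := hf _ _ _ hC hC'
    have hzβ := hβo.mem_trans hzy hy
    exact ⟨z, hz, (hβo.mem hzβ).mem_trans hxα hαz, hzβ⟩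
  obtain ⟨g, hg⟩ := hc1 β hβ hβc
  obtain ⟨-, δ, hδ, hgf, hgc⟩ := hc2 β g hg
  obtain ⟨ξ, hξ, γ, hξγ, hle⟩ := hgc _ hηβ
  have hγβ := isFunc_cod hgf hξγ
  have hγη : γ ∉ (η : ZFSet) := by
    rcases hle with h | h
    exacts [fun h' => ZFSet.mem_asymm h h', fun h' => ZFSet.mem_irrefl _ (h ▸ h')]
  obtain ⟨C, -, hC⟩ := hf1' γ (hθ.mem_trans hγβ hβ) hγη
  refine (hf2 _ _ hC).2.2 ⟨β, hmem γ C hγβ hC, g, (Mdl.of_opair hc' hg).2, hg, ξ, ?_, hξγ⟩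
  rcases ZFSet.mem_insert_iff.1 hδ with rfl | hδ
  exacts [hξ, isOrdinal_omega.mem_trans hξ hδ]

end TransModel

namespace TransModel

universe u

variable {M N : Set ZFSet.{u}} [Mdl M] [Mdl N] {j : M ↪ₑ[ZFLang] N} {κ : ZFSet.{u}}

/-- The pointwise image of a fixed regular ordinal is an `ω`-club in `N`. -/
theorem omegaClub_image (hOrd : SameOrdinals M N)
    (hA : ∀ α : ZFSet, α.IsOrdinal → α ∈ M → ∃ z ∈ N, ImageSet M N j α z)
    (hreg : ∀ α : ZFSet, α.IsOrdinal → α ∈ M → RegularIn M α → RegularIn N α) {θ C : ZFSet.{u}}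
    (hθ : θ.IsOrdinal) (hθM : θ ∈ M) (hr : RegularIn M θ) (hω : ZFSet.omega ∈ θ)
    (hj : ext j θ = θ) (hC : ∀ w, w ∈ C ↔ ∃ y, y ∈ θ ∧ w = ext j y) : OmegaClub N θ C := by
  have hmem : ∀ y, y ∈ θ → ext j y ∈ θ := fun y hy => by
    rw [← hj]
    exact (ext_mem_iff (Mdl.trans M hθM hy) hθM).2 hy
  refine ⟨fun w hw => ?_, fun ξ hξ => ?_, fun β hβ hβc hlim => ?_⟩
  · obtain ⟨y, hy, rfl⟩ := (hC w).1 hw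
    exact hmem y hy
  · obtain ⟨γ, hγ, hξγ⟩ := Mdl.regular_limit hθ hθM hr hω hξ
    exact ⟨ext j γ, (hC _).2 ⟨γ, hγ, rfl⟩,
      subset_ext hOrd (Mdl.trans M hθM hγ) (hθ.mem hγ) hξγ⟩
  · obtain ⟨e, he, hej⟩ := exists_graph hOrd hθ hθM (hA θ hθ hθM)
    have hθN := (hOrd θ hθ).1 hθM
    have hβo := hθ.mem hβ
    have hβN := Mdl.trans N hθN hβ
    lift e to N using he
    obtain ⟨b, hb⟩ : ∃ b : N, (b : ZFSet) = β := ⟨⟨β, hβN⟩, rfl⟩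
    have hD : D1 N fun ξ => ∃ v, v ∈ (b : ZFSet) ∧ ξ.pair v ∈ (e : ZFSet) := inferInstance
    have hσN := Mdl.sep_mem hD hθN
    have hσ : ∀ ξ, ξ ∈ ZFSet.sep (fun ξ => ∃ v, v ∈ (b : ZFSet) ∧ ξ.pair v ∈ (e : ZFSet)) θ ↔
        ξ ∈ θ ∧ ext j ξ ∈ β := by
      intro ξ
      rw [ZFSet.mem_sep, hb]
      refine and_congr_right fun hξ => ⟨?_, fun h => ⟨_, h, (hej _ _).2 ⟨hξ, rfl⟩⟩⟩
      rintro ⟨v, hv, hξv⟩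
      exact ((hej _ _).1 hξv).2 ▸ hv
    generalize ZFSet.sep (fun ξ => ∃ v, v ∈ (b : ZFSet) ∧ ξ.pair v ∈ (e : ZFSet)) θ = σ at hσN hσ
    have hσo : σ.IsOrdinal := by
      rw [ZFSet.isOrdinal_iff_forall_mem_isOrdinal]
      refine ⟨fun x hx y hy => ?_, fun x hx => hθ.mem ((hσ x).1 hx).1⟩
      have h := (hσ x).1 hx
      have hyθ := hθ.mem_trans hy h.1
      exact (hσ y).2 ⟨hyθ, hβo.mem_trans
        ((ext_mem_iff (Mdl.trans M hθM hyθ) (Mdl.trans M hθM h.1)).2 hy) h.2⟩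
    have hσM := (hOrd σ hσo).2 hσN
    have hσβ : σ ⊆ β := by
      intro x hx
      have h := (hσ x).1 hx
      have hxo := hθ.mem h.1
      rcases (hxo.subset_iff_eq_or_mem ((isOrdinal_ext (Mdl.trans M hθM h.1)).2 hxo)).1
        (subset_ext hOrd (Mdl.trans M hθM h.1) hxo) with h' | h'
      exacts [h'.symm ▸ h.2, hβo.mem_trans h' h.2]
    have hσθ : σ ∈ θ := by
      rcases (hσo.subset_iff_eq_or_mem hβo).1 hσβ with h | h
      exacts [h ▸ hβ, hθ.mem_trans h hβ]
    have hcw : Cw N σ := by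
      obtain ⟨δ, hδ, s, hs, hsf, hsc⟩ := hβc
      have hδN : δ ∈ N := by
        rcases ZFSet.mem_insert_iff.1 hδ with rfl | hδ
        exacts [Mdl.omega_mem N, Mdl.trans N (Mdl.omega_mem N) hδ]
      lift s to N using hs
      have hD : D2 N fun i ξ => ∃ v, v ∈ (b : ZFSet) ∧ (i.pair v ∈ (s : ZFSet) ∧
        ∃ w, w ∈ (b : ZFSet) ∧ (ξ.pair w ∈ (e : ZFSet) ∧ v ∈ w)) := inferInstance
      obtain ⟨t, ht, htf, htR⟩ := Mdl.exists_func hD hδN hσN fun i hi => by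
        obtain ⟨v, hv, hiv⟩ := isFunc_value hsf hi
        obtain ⟨w, hw, hvw, hwβ⟩ := hlim v hv
        obtain ⟨ξ, hξ, rfl⟩ := (hC w).1 hw
        rw [hb]
        exact ⟨ξ, (hσ ξ).2 ⟨hξ, hwβ⟩, v, hv, hiv, _, hwβ, (hej _ _).2 ⟨hξ, rfl⟩, hvw⟩
      refine ⟨δ, hδ, t, ht, htf, fun x hx => ?_⟩
      have hx' := (hσ x).1 hx
      obtain ⟨i, hi, v, hiv, hle⟩ := hsc _ hx'.2
      obtain ⟨ξ, hξ, hiξ⟩ := isFunc_value htf hi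
      refine ⟨i, hi, ξ, hiξ, Or.inl ?_⟩
      obtain ⟨v', -, hiv', w, hw, hξw, hvw⟩ := htR i ξ hiξ
      obtain rfl := isFunc_unique hsf hiv hiv'
      obtain ⟨hξθ, rfl⟩ := (hej _ _).1 hξw
      rw [hb] at hw
      have hlt : ext j x ∈ ext j ξ := by
        rcases hle with h | h
        exacts [(hβo.mem hw).mem_trans h hvw, h ▸ hvw]
      exact (ext_mem_iff (Mdl.trans M hθM hx'.1) (Mdl.trans M hθM hξθ)).1 hlt
    refine (hC β).2 ⟨σ, hσθ, ?_⟩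
    rcases hβo.mem_trichotomous ((isOrdinal_ext (j := j) hσM).2 hσo) with h | h | h
    · obtain ⟨y, hy, hle⟩ := (Cw.left hOrd hA hreg hσo hσM hcw).exists_ext hσM h
      have hyβ := ((hσ y).1 hy).2
      rcases hle with hle | hle
      exacts [(ZFSet.mem_asymm hle hyβ).elim, (ZFSet.mem_irrefl _ (hle ▸ hyβ)).elim]
    · exact h
    · exact (ZFSet.mem_irrefl _ ((hσ σ).2 ⟨hσθ, h⟩)).elim

/-- No critical sequence is bounded when pointwise images belong to `N` and regularity is
upward absolute. -/
theorem _root_.IsCrit.not_bounded (h : IsCrit M N j κ) (hOrd : SameOrdinals M N)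
    (hA : ∀ α : ZFSet, α.IsOrdinal → α ∈ M → ∃ z ∈ N, ImageSet M N j α z)
    (hreg : ∀ α : ZFSet, α.IsOrdinal → α ∈ M → RegularIn M α → RegularIn N α) {l : ZFSet.{u}}
    (hl : l.IsOrdinal) (hlM : l ∈ M) (hmem : ∀ n, (ext j)^[n] κ ∈ l)
    (hcof : ∀ γ ∈ l, ∃ n, γ ∈ (ext j)^[n] κ ∨ γ = (ext j)^[n] κ) : False := by
  have hjl := ext_sup_iterate hOrd hl hlM hmem hcof
    (Cw.left hOrd hA hreg hl hlM (h.cw_right hOrd hl hlM (hA l hl hlM) hmem hcof))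
  obtain ⟨θ, hθM, hθ, hr, hlθ, hj⟩ := exists_regular_fixed hOrd hreg hl hlM hjl
  have hκθ : κ ∈ θ := hθ.mem_trans (hmem 0) hlθ
  have hω : ZFSet.omega ∈ θ := hθ.mem_trans h.omega_mem hκθ
  obtain ⟨z, hz, hzj⟩ := hA θ hθ hθM
  rw [imageSet_iff hθM] at hzj
  have hclub := omegaClub_image hOrd hA hreg hθ hθM hr hω hj hzj
  obtain ⟨c, hc, hcf, hc1, hc2⟩ := Mdl.exists_ladder hθM
  obtain ⟨H, hHM, hH⟩ : ∃ H, H ∈ M ∧ ∀ γ, γ ∈ H ↔ γ ∈ θ ∧ Guessed M θ c γ := by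
    lift c to M using hc
    have hθM' := hθM
    lift θ to M using hθM
    have hD : D1 M fun γ => Guessed M θ c γ := inferInstance
    exact ⟨_, Mdl.sep_mem hD hθM', fun γ => ZFSet.mem_sep⟩
  have hran : ∀ γ, γ ∈ ext j H → ∃ y, y ∈ H ∧ γ = ext j y := by
    intro γ hγ
    have hg : Guessed N θ (ext j c) γ := by
      have hc' := hc
      lift c to M using hc
      have hθM' := hθM
      lift θ to M using hθM
      have hHM' := hHM
      lift H to M using hHM
      rw [ext_coe] at hγ hj ⊢
      rw [← hj]
      exact (Tr.transfer (j := j) (P := ∀ γ, γ ∈ (H : ZFSet) → Guessed M θ c γ)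
        (Q := ∀ γ, γ ∈ (j H : ZFSet) → Guessed N (j θ) (j c) γ) inferInstance).1
        (fun γ hγ => ((hH γ).1 hγ).2) γ hγ
    obtain ⟨β, hβ, g, -, hβg, i, hi, hiγ⟩ := hg z hz hclub
    obtain ⟨β, hβθ, rfl⟩ := (hzj β).1 hβ
    obtain ⟨g, hβg', rfl⟩ := ext_value hc (Mdl.trans M hθM hβθ) (hcf β) hβg
    obtain ⟨-, δ, hδ, hgf, -⟩ := hc2 β g hβg'
    obtain ⟨n, rfl⟩ := mem_omega_iff.1 hi
    rw [← ext_nat (j := j) n] at hiγ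
    obtain ⟨y, hy, rfl⟩ := ext_value (Mdl.of_opair hc hβg').2 (Mdl.trans M (Mdl.omega_mem M) hi)
      (fun _ _ => isFunc_unique hgf) hiγ
    have hyM := Mdl.trans M hθM (hθ.mem_trans (isFunc_cod hgf hy) hβθ)
    exact ⟨y, (ext_mem_iff hyM hHM).1 hγ, rfl⟩
  obtain ⟨δ, F, hδM, hFM, hδ, h1, h2, h3, h4, h5⟩ := Mdl.exists_enumeration hHM
  have hκδ : κ ∉ δ := by
    intro hκ
    obtain ⟨y, hy, hκy⟩ : ∃ y, y ∈ ext j H ∧ κ.pair y ∈ ext j F := by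
      have hκ' := subset_ext (j := j) hOrd hδM hδ hκ
      lift H to M using hHM
      lift F to M using hFM
      lift δ to M using hδM
      rw [ext_coe] at hκ' ⊢
      rw [ext_coe]
      exact (Tr.transfer (j := j) (P := ∀ ξ, ξ ∈ (δ : ZFSet) → ∃ y, y ∈ (H : ZFSet) ∧
        ξ.pair y ∈ (F : ZFSet)) (Q := ∀ ξ, ξ ∈ (j δ : ZFSet) → ∃ y, y ∈ (j H : ZFSet) ∧
        ξ.pair y ∈ (j F : ZFSet)) inferInstance).1 (fun ξ hξ => by
          obtain ⟨y, hy⟩ := h2 ξ hξ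
          exact ⟨y, (h1 _ _ hy).2, hy⟩) κ hκ'
    obtain ⟨y, hyH, rfl⟩ := hran y hy
    obtain ⟨ξ, hξ⟩ := h3 y hyH
    have hξδ := (h1 _ _ hξ).1
    refine h.ne_ext hOrd (Mdl.trans M hδM hξδ) (hδ.mem hξδ) ?_
    have hκN := (hOrd κ h.1).1 h.2.1
    have hξM := Mdl.trans M hδM hξδ
    have hyM := Mdl.trans M hHM hyH
    lift F to M using hFM
    lift ξ to M using hξM
    lift y to M using hyM
    rw [ext_coe, ext_coe] at hκy
    rw [ext_coe]
    exact (Tr.transfer (j := j) (P := ∀ ζ, ζ ∈ M → ζ.pair y ∈ (F : ZFSet) → ζ = ξ)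
      (Q := ∀ ζ, ζ ∈ N → ζ.pair (j y) ∈ (j F : ZFSet) → ζ = j ξ) inferInstance).1
      (fun ζ _ hζ => h5 _ _ _ hζ hξ) κ hκN hκy
  have hδθ : δ ∈ θ := by
    rcases hδ.mem_trichotomous h.1 with h' | h' | h'
    exacts [hθ.mem_trans h' hκθ, h'.symm ▸ hκθ, (hκδ h').elim]
  obtain ⟨γ, hγ, hb⟩ : ∃ γ, γ ∈ θ ∧ ∀ x ∈ δ, ∃ y, y ∈ γ ∧ x.pair y ∈ F := by
    lift F to M using hFM
    have hD : D2 M fun x y => x.pair y ∈ (F : ZFSet) := inferInstance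
    refine Mdl.regular_bound hD hθ hθM hr hδθ fun x hx => ?_
    obtain ⟨y, hy⟩ := h2 x hx
    exact ⟨y, ((hH y).1 (h1 _ _ hy).2).1, hy⟩
  obtain ⟨τ, hτ, hτγ, hτg⟩ := Mdl.exists_guessed hθ hθM hr hω hc hc1 hc2 hγ
  obtain ⟨ξ, hξ⟩ := h3 τ ((hH τ).2 ⟨hτ, hτg⟩)
  obtain ⟨y, hy, hξy⟩ := hb ξ (h1 _ _ hξ).1
  exact hτγ (h4 _ _ _ hξ hξy ▸ hy)

end TransModel

open TransModel

/-- Theorem 1.1, Kunen-style: for a nontrivial elementary embedding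
`j : M → N` between transitive models of ZFC with the same ordinals, either the critical
sequence is cofinal in the ordinals, or some `j[α] ∉ N`, or some ordinal is regular in `M`
and singular in `N`. -/
theorem stmt0 (M N : Set ZFSet) (hM : IsZFCModel M) (hN : IsZFCModel N)
    (hOrd : SameOrdinals M N) (j : ↥M ↪ₑ[ZFLang] ↥N)
    (hnt : ∃ x : ↥M, ((j x : ↥N) : ZFSet) ≠ (x : ZFSet)) :
    (∃ c : ℕ → ZFSet,
        (∀ n, (c n).IsOrdinal ∧ c n ∈ M) ∧
        IsCrit M N (⇑j) (c 0) ∧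
        (∀ n (h : c n ∈ M), ((j ⟨c n, h⟩ : ↥N) : ZFSet) = c (n + 1)) ∧
        (∀ x : ZFSet, x.IsOrdinal → x ∈ M → ∃ n, x ∈ c n ∨ x = c n)) ∨
    (∃ α : ZFSet, α.IsOrdinal ∧ α ∈ M ∧ ¬ ∃ z ∈ N, ImageSet M N (⇑j) α z) ∨
    (∃ α : ZFSet, α.IsOrdinal ∧ α ∈ M ∧ RegularIn M α ∧ ¬ RegularIn N α) := by
  have : Mdl M := ⟨hM⟩
  have : Mdl N := ⟨hN⟩
  obtain ⟨κ, hκ⟩ := exists_isCrit hnt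
  by_contra! hcon
  obtain ⟨h1, h2, h3⟩ := hcon
  obtain ⟨x, hx, hxM, hb⟩ := h1 (fun n => (ext j)^[n] κ)
    (fun n => ⟨(hκ.iterate hOrd n).1, (hκ.iterate hOrd n).2.1⟩) hκ fun n h => by
      rw [ext_mk, Function.iterate_succ_apply']
  have hmem : ∀ n, (ext j)^[n] κ ∈ x := fun n => by
    rcases hx.mem_trichotomous (hκ.iterate hOrd n).1 with h | h | h
    exacts [((hb n).1 h).elim, ((hb n).2 h).elim, h]
  obtain ⟨l, hl, hlmem, hle, hmin⟩ := exists_least (P := fun l => ∀ n, (ext j)^[n] κ ∈ l) hx hmem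
  have hlM : l ∈ M := by
    rcases hle with rfl | h
    exacts [hxM, Mdl.trans M hxM h]
  refine hκ.not_bounded hOrd h2 h3 hl hlM hlmem fun γ hγ => ?_
  obtain ⟨n, hn⟩ := not_forall.1 (hmin γ hγ)
  refine ⟨n, ?_⟩
  rcases (hl.mem hγ).mem_trichotomous (hκ.iterate hOrd n).1 with h | h | h
  exacts [Or.inl h, Or.inr h, (hn h).elim]
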